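/- arXiv:1305.3268 — 2 statements merged into one kernel-verified Lean document; each statement's English description precedes it below -/
import Mathlib

section
/- (Generalized rounding lemma.) Let n, N ≥ 2 be positive integers and set Δ = ((n+1)N)^{2n}. Let 𝒱 ⊆ ℤ^n ∩ [−N,N]^n be a nonempty convex independent set, let 𝒳 = conv(𝒱) ∩ ℤ^n, let r = xcs(conv(𝒳)), and let 0 < δ ≤ (16 r³ (n + r²))^{−1}. Then for every i ∈ {1,…,n+r²} there exist: an integer vector a_i ∈ ℤ^n with ‖a_i‖_∞ ≤ Δ; an integer b_i with |b_i| ≤ Δ; and an r×r PSD matrix U_i with ‖U_i‖ ≤ √(rΔ), whose entries are integer multiples of δ/Δ and have absolute value at most 8 r^{3/2} Δ, such that 𝒳 = {x ∈ ℤ^n : ∃ Y ∈ S₊^r with ‖Y‖ ≤ √(rΔ) such that |b_i − a_iᵀx − Tr(Y U_i)| ≤ 1/(4(n+r²)) for all i ∈ {1,…,n+r²}}. -/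
open Matrix

/-- Operator norm (ℓ² → ℓ²) of a square real matrix. -/
noncomputable def opNorm {r : ℕ} (M : Matrix (Fin r) (Fin r) ℝ) : ℝ :=
  ‖LinearMap.toContinuousLinearMap (Matrix.toEuclideanLin M)‖

/-- `K` has a semidefinite extended formulation of size `r`. -/
def HasSdpEF {n : ℕ} (K : Set (Fin n → ℝ)) (r : ℕ) : Prop :=
  ∃ (m : ℕ) (a : Fin m → (Fin n → ℝ)) (U : Fin m → Matrix (Fin r) (Fin r) ℝ) (b : Fin m → ℝ),
    (∀ i, (U i).PosSemidef) ∧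
    K = {x | ∃ Y : Matrix (Fin r) (Fin r) ℝ, Y.PosSemidef ∧
          ∀ i, a i ⬝ᵥ x + (U i * Y).trace = b i}

/-- Semidefinite extension complexity: the minimum size of a semidefinite EF. -/
noncomputable def xcs {n : ℕ} (K : Set (Fin n → ℝ)) : ℕ :=
  sInf {r | HasSdpEF K r}

/-- A point of `ℝⁿ` is integral if all its coordinates are integers. -/
def IsIntegralPoint {n : ℕ} (x : Fin n → ℝ) : Prop := ∀ k, ∃ m : ℤ, x k = (m : ℝ)

theorem abs_entry_le_opNorm {r : ℕ} (M : Matrix (Fin r) (Fin r) ℝ) (k l : Fin r) :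
    |M k l| ≤ opNorm M := by
  have h := (LinearMap.toContinuousLinearMap (Matrix.toEuclideanLin M)).le_opNorm
    (EuclideanSpace.single l (1 : ℝ))
  have h2 := PiLp.norm_apply_le
    ((LinearMap.toContinuousLinearMap (Matrix.toEuclideanLin M)) (EuclideanSpace.single l (1 : ℝ))) k
  simp [Matrix.toLpLin_apply] at h h2
  exact h2.trans h

theorem Matrix.PosSemidef.sq_entry_le {r : ℕ} {M : Matrix (Fin r) (Fin r) ℝ}
    (hM : M.PosSemidef) (k l : Fin r) : M k l ^ 2 ≤ M k k * M l l := by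
  have h := (hM.submatrix ![k, l]).det_nonneg
  have hs : M l k = M k l := by simpa using congrFun (congrFun hM.isHermitian k) l
  rw [Matrix.det_fin_two] at h
  simp [hs] at h
  nlinarith

theorem Matrix.PosSemidef.opNorm_le_trace {r : ℕ} {M : Matrix (Fin r) (Fin r) ℝ}
    (hM : M.PosSemidef) : opNorm M ≤ M.trace := by
  refine ContinuousLinearMap.opNorm_le_bound _ hM.trace_nonneg fun x => ?_
  refine abs_le_of_sq_le_sq' ?_ (by have := hM.trace_nonneg; positivity) |>.2
  rw [mul_pow, EuclideanSpace.norm_sq_eq, EuclideanSpace.norm_sq_eq]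
  have h1 : ∀ k, (∑ l, M k l * x l) ^ 2 ≤ (∑ l, M k l ^ 2) * ∑ l, x l ^ 2 := fun k =>
    Finset.sum_mul_sq_le_sq_mul_sq _ _ _
  have h2 : ∑ k, ∑ l, M k l ^ 2 ≤ M.trace ^ 2 := by
    rw [sq, Matrix.trace, Finset.sum_mul_sum]
    exact Finset.sum_le_sum fun k _ => Finset.sum_le_sum fun l _ => hM.sq_entry_le k l
  simp only [Real.norm_eq_abs, sq_abs]
  calc _ = ∑ k, (∑ l, M k l * x l) ^ 2 := by
        simp [Matrix.toLpLin_apply, Matrix.mulVec, dotProduct]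
    _ ≤ ∑ k, (∑ l, M k l ^ 2) * ∑ l, x l ^ 2 := Finset.sum_le_sum fun k _ => h1 k
    _ = (∑ k, ∑ l, M k l ^ 2) * ∑ l, x l ^ 2 := by rw [Finset.sum_mul]
    _ ≤ _ := by gcongr

/-- Rounding a PSD matrix to a grid of mesh `g` after a shift of the diagonal by `r * g`. -/
noncomputable def gridRound {r : ℕ} (g : ℝ) (M : Matrix (Fin r) (Fin r) ℝ) :
    Matrix (Fin r) (Fin r) ℝ :=
  fun k l => ((round (M k l / g) + if k = l then (r : ℤ) else 0 : ℤ) : ℝ) * g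

theorem abs_round_div_mul_sub_le {g : ℝ} (hg : 0 < g) (t : ℝ) :
    |(round (t / g) : ℝ) * g - t| ≤ g / 2 := by
  have h := abs_sub_round (t / g)
  have : (round (t / g) : ℝ) * g - t = -((t / g - round (t / g)) * g) := by
    field_simp; ring
  rw [this, abs_neg, abs_mul, abs_of_pos hg]
  nlinarith

theorem sum_abs_gridRound_sub_le {r : ℕ} {g : ℝ} (hg : 0 < g) (M : Matrix (Fin r) (Fin r) ℝ) :
    ∑ k, ∑ l, |gridRound g M k l - M k l| ≤ 2 * (r : ℝ) ^ 2 * g := by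
  have h : ∀ k l, |gridRound g M k l - M k l| ≤ g / 2 + if k = l then (r : ℝ) * g else 0 := by
    intro k l
    have h1 := abs_round_div_mul_sub_le hg (M k l)
    have : gridRound g M k l - M k l = ((round (M k l / g) : ℝ) * g - M k l) +
        if k = l then (r : ℝ) * g else 0 := by
      unfold gridRound; split_ifs <;> push_cast <;> ring
    rw [this]
    refine (abs_add_le _ _).trans (add_le_add h1 (le_of_eq (abs_of_nonneg ?_)))
    split_ifs <;> positivity
  calc _ ≤ ∑ k : Fin r, ∑ l : Fin r, (g / 2 + if k = l then (r : ℝ) * g else 0) :=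
        Finset.sum_le_sum fun k _ => Finset.sum_le_sum fun l _ => h k l
    _ = (3 / 2) * (r : ℝ) ^ 2 * g := by simp [Finset.sum_add_distrib]; ring
    _ ≤ _ := by
      have : 0 ≤ (r : ℝ) ^ 2 * g := by positivity
      nlinarith

theorem Matrix.PosSemidef.gridRound {r : ℕ} {g : ℝ} (hg : 0 < g)
    {M : Matrix (Fin r) (Fin r) ℝ} (hM : M.PosSemidef) : (gridRound g M).PosSemidef := by
  have hs : ∀ k l, M l k = M k l := fun k l => by
    simpa using congrFun (congrFun hM.isHermitian k) l
  refine .of_dotProduct_mulVec_nonneg ?_ fun x => ?_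
  · ext k l
    simp [_root_.gridRound, hs k l, eq_comm]
  · have h0 := hM.dotProduct_mulVec_nonneg x
    simp only [star_trivial] at h0 ⊢
    set e : Matrix (Fin r) (Fin r) ℝ := fun k l => (round (M k l / g) : ℝ) * g - M k l
    have hdec : _root_.gridRound g M = M + e + ((r : ℝ) * g) • (1 : Matrix (Fin r) (Fin r) ℝ) := by
      ext k l
      have hkl : e k l = (round (M k l / g) : ℝ) * g - M k l := rfl
      simp only [_root_.gridRound, Matrix.add_apply, hkl, Matrix.smul_apply, Matrix.one_apply,
        smul_eq_mul]
      split_ifs <;> push_cast <;> ring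
    have he1 : |x ⬝ᵥ e *ᵥ x| ≤ (g / 2) * (∑ k, |x k|) ^ 2 := by
      rw [dotProduct, sq, Finset.sum_mul_sum, Finset.mul_sum]
      refine (Finset.abs_sum_le_sum_abs _ _).trans (Finset.sum_le_sum fun k _ => ?_)
      rw [abs_mul, Matrix.mulVec, dotProduct, Finset.mul_sum]
      refine (mul_le_mul_of_nonneg_left (Finset.abs_sum_le_sum_abs _ _) (abs_nonneg _)).trans ?_
      rw [Finset.mul_sum]
      refine Finset.sum_le_sum fun l _ => ?_
      rw [abs_mul]
      have := abs_round_div_mul_sub_le hg (M k l)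
      have h3 : 0 ≤ |x k| * |x l| := by positivity
      calc |x k| * (|e k l| * |x l|) = |e k l| * (|x k| * |x l|) := by ring
        _ ≤ _ := mul_le_mul_of_nonneg_right this h3
    have he2 : (∑ k, |x k|) ^ 2 ≤ r * (x ⬝ᵥ x) := by
      have := sq_sum_le_card_mul_sum_sq (s := Finset.univ) (f := fun k => |x k|)
      simpa [dotProduct, sq] using this
    rw [hdec]
    simp only [Matrix.add_mulVec, dotProduct_add, Matrix.smul_mulVec, Matrix.one_mulVec,
      dotProduct_smul, smul_eq_mul]
    have h4 : 0 ≤ x ⬝ᵥ x := Finset.sum_nonneg fun k _ => mul_self_nonneg _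
    have h5 := (abs_le.1 he1).1
    have h6 : 0 ≤ (r : ℝ) * g * (x ⬝ᵥ x) := by positivity
    nlinarith

theorem abs_trace_mul_le {r : ℕ} (Y E : Matrix (Fin r) (Fin r) ℝ) {c : ℝ}
    (hY : opNorm Y ≤ c) : |(Y * E).trace| ≤ c * ∑ k, ∑ l, |E k l| := by
  simp only [Matrix.trace, Matrix.diag_apply, Matrix.mul_apply]
  rw [Finset.sum_comm, Finset.mul_sum]
  refine (Finset.abs_sum_le_sum_abs _ _).trans (Finset.sum_le_sum fun k _ => ?_)
  rw [Finset.mul_sum]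
  refine (Finset.abs_sum_le_sum_abs _ _).trans (Finset.sum_le_sum fun l _ => ?_)
  rw [abs_mul]
  exact mul_le_mul_of_nonneg_right ((abs_entry_le_opNorm Y l k).trans hY) (abs_nonneg _)

theorem trace_gridRound_le {r : ℕ} {g : ℝ} (hg : 0 < g) (M : Matrix (Fin r) (Fin r) ℝ) :
    (gridRound g M).trace ≤ M.trace + 2 * (r : ℝ) ^ 2 * g := by
  have h := sum_abs_gridRound_sub_le hg M
  have : (gridRound g M).trace - M.trace ≤ ∑ k, ∑ l, |gridRound g M k l - M k l| := by
    rw [Matrix.trace, Matrix.trace, ← Finset.sum_sub_distrib]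
    refine Finset.sum_le_sum fun k _ => (le_abs_self _).trans ?_
    exact Finset.single_le_sum (f := fun l => |gridRound g M k l - M k l|)
      (fun l _ => abs_nonneg _) (Finset.mem_univ k)
  linarith

theorem exists_bounded_spanning_selection {ι E : Type*} [Finite ι] [Nonempty ι] [AddCommGroup E]
    [Module ℝ E] [FiniteDimensional ℝ E] {d : ℕ} (hd : Module.finrank ℝ E ≤ d) (w : ι → E) :
    ∃ σ : Fin d → ι, ∀ j, ∃ c : Fin d → ℝ, (∀ i, |c i| ≤ 1) ∧ w j = ∑ i, c i • w (σ i) := by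
  classical
  set W := Submodule.span ℝ (Set.range w) with hW
  let u : ι → W := fun j => ⟨w j, Submodule.subset_span ⟨j, rfl⟩⟩
  have hu : Submodule.span ℝ (Set.range u) = ⊤ := Submodule.span_range_subtype_eq_top_iff _ _ |>.2 rfl
  set k := Module.finrank ℝ W with hk
  have hkd : k ≤ d := (Submodule.finrank_le W).trans hd
  let B := Module.finBasis ℝ W
  obtain ⟨τ, hτ⟩ := Finite.exists_max fun τ : Fin k → ι => |B.det (u ∘ τ)|
  have hpos : 0 < |B.det (u ∘ τ)| := by
    obtain ⟨κ, f, -, hfs, hfl⟩ := exists_linearIndependent' ℝ u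
    have : ⊤ ≤ Submodule.span ℝ (Set.range (u ∘ f)) := by rw [hfs, hu]
    let b := Module.Basis.mk hfl this
    have e := B.indexEquiv b
    have h1 : (u ∘ (f ∘ e)) = b.reindex e.symm := by
      ext i; simp [b]
    refine lt_of_lt_of_le ?_ (hτ (f ∘ e))
    rw [h1, abs_pos]
    exact (B.isUnit_det _).ne_zero
  have hdet : IsUnit (B.det (u ∘ τ)) := (abs_pos.1 hpos).isUnit
  obtain ⟨hli, hsp⟩ := (B.is_basis_iff_det).2 hdet
  let σ : Fin d → ι := fun i => if h : i.1 < k then τ ⟨i, h⟩ else Classical.arbitrary ι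
  refine ⟨σ, fun j => ?_⟩
  let b := Module.Basis.mk hli hsp.ge
  refine ⟨fun i => if h : i.1 < k then b.repr (u j) ⟨i, h⟩ else 0, fun i => ?_, ?_⟩
  · by_cases h : i.1 < k
    · simp only [h, dite_true]
      have h2 := congrArg (fun f => f (u j)) (B.det_smul_mk_coord_eq_det_update hli hsp.ge ⟨i, h⟩)
      simp only [LinearMap.smul_apply, Module.Basis.coord_apply, smul_eq_mul] at h2
      have h3 : B.det (Function.update (u ∘ τ) ⟨i, h⟩ (u j)) =
          B.det (u ∘ Function.update τ ⟨i, h⟩ j) := by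
        rw [Function.comp_update]
      have h4 := hτ (Function.update τ ⟨i, h⟩ j)
      simp only [← h3] at h4
      have h5 : |B.det (u ∘ τ)| * |b.repr (u j) ⟨i, h⟩| ≤ |B.det (u ∘ τ)| := by
        rw [← abs_mul, h2]; exact h4
      exact le_of_mul_le_mul_left (by simpa using h5) hpos
    · simp [h]
  · have h1 : u j = ∑ i, b.repr (u j) i • u (τ i) := by
      conv_lhs => rw [← b.sum_repr (u j)]
      simp [b]
    have h2 : w j = ∑ i, b.repr (u j) i • w (τ i) := by
      simpa [u] using congrArg (Subtype.val) h1
    rw [h2]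
    obtain ⟨m, rfl⟩ := Nat.exists_eq_add_of_le hkd
    rw [Fin.sum_univ_add]
    simp [σ]
    rfl

open Filter Topology in
theorem span_tight_rows_eq_top_of_extreme {κ J : Type*} [Finite κ] [Fintype J]
    (R : κ → J → ℝ) (h : κ → ℝ) {y : J → ℝ}
    (hy : y ∈ Set.extremePoints ℝ {x : J → ℝ | ∀ t, R t ⬝ᵥ x ≤ h t}) :
    Submodule.span ℝ (Set.range fun t : {t // R t ⬝ᵥ y = h t} => R t) = ⊤ := by
  classical
  by_contra hne
  obtain ⟨f, hf0, hf⟩ := Submodule.exists_le_ker_of_lt_top _ (lt_top_iff_ne_top.2 hne)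
  obtain ⟨d, hd⟩ : ∃ d : J → ℝ, ∀ x, f x = x ⬝ᵥ d :=
    ⟨_, fun x => by rw [f.pi_apply_eq_sum_univ x]; rfl⟩
  have hd0 : d ≠ 0 := by
    rintro rfl
    exact hf0 (LinearMap.ext fun x => by simp [hd])
  have htight : ∀ t, R t ⬝ᵥ y = h t → R t ⬝ᵥ d = 0 := fun t ht => by
    rw [← hd]; exact hf (Submodule.subset_span ⟨⟨t, ht⟩, rfl⟩)
  have hyP := hy.1
  have key : ∀ᶠ ε : ℝ in 𝓝 0, ∀ t, R t ⬝ᵥ (y + ε • d) ≤ h t := by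
    rw [eventually_all]
    intro t
    by_cases ht : R t ⬝ᵥ y = h t
    · exact Eventually.of_forall fun ε => by simp [htight t ht, ht]
    · have hlt : R t ⬝ᵥ y < h t := lt_of_le_of_ne (hyP t) ht
      have hc : Continuous fun ε : ℝ => R t ⬝ᵥ (y + ε • d) := by
        simp only [dotProduct_add, dotProduct_smul]; fun_prop
      have := hc.tendsto 0
      simp only [zero_smul, add_zero] at this
      exact (this.eventually (gt_mem_nhds hlt)).mono fun _ h => h.le
  obtain ⟨ε, hε, hball⟩ := Metric.eventually_nhds_iff.1 key
  have h1 := @hball (ε / 2) (by simp [abs_of_pos, hε])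
  have h2 := @hball (-(ε / 2)) (by simp [abs_of_pos, hε])
  have := hy.2 h1 h2 ⟨1 / 2, 1 / 2, by norm_num, by norm_num, by norm_num, by
    ext j; simp; ring⟩
  have h3 : (ε / 2) • d = 0 := by simpa using this
  rcases smul_eq_zero.1 h3 with h4 | h4
  · linarith
  · exact hd0 h4

theorem exists_int_solution_of_homogeneous {ι J : Type*} [Finite ι] [Fintype J]
    {N : ℕ} (hN : 1 ≤ N) (q : ι → J → ℤ) (hq : ∀ i j, |q i j| ≤ N) (c : J → ℝ)
    (hex : ∃ y : J → ℝ, (∀ i, (fun j => (q i j : ℝ)) ⬝ᵥ y ≤ 0) ∧ 0 < c ⬝ᵥ y) :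
    ∃ y : J → ℤ, (∀ j, |y j| ≤ (Fintype.card J).factorial * (N : ℤ) ^ Fintype.card J) ∧
      (∀ i, (fun j => (q i j : ℝ)) ⬝ᵥ (fun j => (y j : ℝ)) ≤ 0) ∧
      0 < c ⬝ᵥ (fun j => (y j : ℝ)) := by
  classical
  have hN' : (1 : ℤ) ≤ N := by exact_mod_cast hN
  let R : ι ⊕ J ⊕ J → J → ℤ :=
    Sum.elim q (Sum.elim (fun j => Pi.single j 1) (fun j => -Pi.single j 1))
  let h : ι ⊕ J ⊕ J → ℤ := Sum.elim (fun _ => 0) (fun _ => 1)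
  have hR : ∀ t j, |R t j| ≤ N := by
    rintro (i | j' | j') j
    · exact hq i j
    · by_cases e : j = j' <;> simp [R, e, hN']
    · by_cases e : j = j' <;> simp [R, e, hN']
  have hh : ∀ t, |h t| ≤ N := by
    rintro (i | j') <;> simp [h, hN']
  let P : Set (J → ℝ) := {x | ∀ t, (fun j => (R t j : ℝ)) ⬝ᵥ x ≤ h t}
  have hPmem : ∀ x, x ∈ P ↔ (∀ i, (fun j => (q i j : ℝ)) ⬝ᵥ x ≤ 0) ∧ ∀ j, |x j| ≤ 1 := by
    intro x
    have e1 : ∀ j, (fun k => ((Pi.single j 1 : J → ℤ) k : ℝ)) = Pi.single j 1 := fun j => by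
      ext k; by_cases e : k = j <;> simp [e]
    have e2 : ∀ j, (fun k => -((Pi.single j 1 : J → ℤ) k : ℝ)) = -Pi.single j 1 := fun j => by
      rw [← e1]; rfl
    simp [P, R, h, Sum.forall, e1, e2, abs_le, forall_and, neg_le, and_comm]
  have hPc : IsCompact P := by
    refine (isCompact_univ_pi fun _ : J => isCompact_Icc (a := (-1 : ℝ)) (b := 1)).of_isClosed_subset
      ?_ fun x hx j _ => abs_le.1 (((hPmem x).1 hx).2 j)
    have : P = ⋂ t, {x | (fun j => (R t j : ℝ)) ⬝ᵥ x ≤ h t} := by ext; simp [P]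
    rw [this]
    exact isClosed_iInter fun t => isClosed_le (by unfold dotProduct; fun_prop) continuous_const
  obtain ⟨y₀, hy₀, hcy₀⟩ := hex
  have hs : 0 < 1 + ‖y₀‖ := by positivity
  have hy₁ : (1 + ‖y₀‖)⁻¹ • y₀ ∈ P := by
    rw [hPmem]
    refine ⟨fun i => ?_, fun j => ?_⟩
    · rw [dotProduct_smul, smul_eq_mul]
      exact mul_nonpos_of_nonneg_of_nonpos (by positivity) (hy₀ i)
    · have := norm_le_pi_norm y₀ j
      rw [Pi.smul_apply, smul_eq_mul, abs_mul, abs_of_pos (inv_pos.2 hs), inv_mul_le_iff₀ hs]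
      rw [Real.norm_eq_abs] at this
      linarith
  let l : StrongDual ℝ (J → ℝ) := LinearMap.toContinuousLinearMap
    { toFun := fun x => c ⬝ᵥ x, map_add' := by simp, map_smul' := by simp }
  have hl : ∀ x, l x = c ⬝ᵥ x := fun x => rfl
  have hF : IsExposed ℝ P (l.toExposed P) := ContinuousLinearMap.toExposed.isExposed
  have hFne : (l.toExposed P).Nonempty := by
    obtain ⟨x, hx, hmax⟩ := hPc.exists_isMaxOn ⟨_, hy₁⟩ l.continuous.continuousOn
    exact ⟨x, hx, fun y hy => hmax hy⟩
  obtain ⟨y, hyF⟩ := (hF.isCompact hPc).extremePoints_nonempty hFne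
  have hyext : y ∈ Set.extremePoints ℝ P := hF.isExtreme.extremePoints_subset_extremePoints hyF
  have hcy : 0 < c ⬝ᵥ y := by
    have := hyF.1.2 _ hy₁
    rw [hl, hl, dotProduct_smul, smul_eq_mul] at this
    exact lt_of_lt_of_le (by positivity) this
  have hspan := span_tight_rows_eq_top_of_extreme (fun t j => (R t j : ℝ)) (fun t => (h t : ℝ)) hyext
  obtain ⟨κ, f, -, hfs, hfl⟩ := exists_linearIndependent' ℝ
    (fun t : {t // (fun j => (R t j : ℝ)) ⬝ᵥ y = h t} => fun j => (R t.1 j : ℝ))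
  let b := Module.Basis.mk hfl (by rw [hfs, hspan])
  let e : J ≃ κ := (Pi.basisFun ℝ J).indexEquiv b
  let M : Matrix J J ℤ := Matrix.of fun i j => R (f (e i)).1 j
  let hv : J → ℤ := fun i => h (f (e i)).1
  have hMy : M.map (Int.cast : ℤ → ℝ) *ᵥ y = fun i => (hv i : ℝ) := by
    ext i; exact (f (e i)).2
  have hMdet : M.det ≠ 0 := by
    have h1 : IsUnit (M.map (Int.cast : ℤ → ℝ)) := by
      rw [← Matrix.linearIndependent_rows_iff_isUnit]
      exact hfl.comp e e.injective
    rw [Matrix.isUnit_iff_isUnit_det, isUnit_iff_ne_zero] at h1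
    rw [← Int.cast_det] at h1
    exact_mod_cast h1
  have hx : ∀ j, ((M.cramer hv j : ℤ) : ℝ) = M.det * y j := by
    have h1 := Matrix.mulVec_cramer M hv
    have h2 : M.map (Int.cast : ℤ → ℝ) *ᵥ (fun j => ((M.cramer hv j : ℤ) : ℝ)) =
        M.map (Int.cast : ℤ → ℝ) *ᵥ ((M.det : ℝ) • y) := by
      rw [Matrix.mulVec_smul, hMy]
      ext i
      have h3 := congrFun h1 i
      simp only [mulVec, dotProduct, Pi.smul_apply, smul_eq_mul, Matrix.map_apply] at h3 ⊢
      exact_mod_cast h3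
    have h4 : Function.Injective (M.map (Int.cast : ℤ → ℝ)).mulVec := by
      rw [Matrix.mulVec_injective_iff_isUnit, Matrix.isUnit_iff_isUnit_det, isUnit_iff_ne_zero,
        ← Int.cast_det]
      exact_mod_cast hMdet
    exact fun j => congrFun (h4 h2) j
  have hout : (fun j => ((M.det.sign * M.cramer hv j : ℤ) : ℝ)) = |(M.det : ℝ)| • y := by
    ext j
    rw [Int.cast_mul, hx, ← mul_assoc, ← Int.cast_mul, Int.sign_mul_self_eq_abs]
    simp
  have hdpos : 0 < |(M.det : ℝ)| := abs_pos.2 (by exact_mod_cast hMdet)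
  refine ⟨fun j => M.det.sign * M.cramer hv j, fun j => ?_, fun i => ?_, ?_⟩
  · rw [abs_mul, Matrix.cramer_apply]
    have h1 := Matrix.det_le (A := M.updateCol j hv) (abv := AbsoluteValue.abs) (x := (N : ℤ))
      (fun i k => by
        by_cases hk : k = j
        · subst hk; simpa using hh _
        · rw [Matrix.updateCol_ne hk]; exact hR _ k)
    have h2 : |M.det.sign| = 1 := by
      rw [Int.abs_eq_natAbs, Int.natAbs_sign_of_ne_zero hMdet]; rfl
    rw [h2, one_mul]
    simpa using h1
  · rw [hout, dotProduct_smul, smul_eq_mul]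
    exact mul_nonpos_of_nonneg_of_nonpos hdpos.le (((hPmem y).1 hyext.1).1 i)
  · rw [hout, dotProduct_smul, smul_eq_mul]
    exact mul_pos hdpos hcy

theorem exists_int_separator {n N : ℕ} (hN : 1 ≤ N) {ι : Type*} [Finite ι] (v : ι → Fin n → ℤ)
    (hv : ∀ i k, |v i k| ≤ N) {z : Fin n → ℝ}
    (hz : z ∉ convexHull ℝ (Set.range fun i k => (v i k : ℝ))) :
    ∃ a : Fin n → ℤ, (∀ k, |a k| ≤ (n + 1).factorial * (N : ℤ) ^ (n + 1)) ∧
      ∀ i, (fun k => (a k : ℝ)) ⬝ᵥ (fun k => (v i k : ℝ)) < (fun k => (a k : ℝ)) ⬝ᵥ z := by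
  have hN' : (1 : ℤ) ≤ N := by exact_mod_cast hN
  obtain ⟨f, u, hfu, huf⟩ := geometric_hahn_banach_closed_point (convex_convexHull ℝ _)
    ((Set.finite_range fun i k => (v i k : ℝ)).isCompact_convexHull ℝ).isClosed hz
  obtain ⟨d, hd⟩ : ∃ d : Fin n → ℝ, ∀ x, f x = x ⬝ᵥ d :=
    ⟨_, fun x => by
      rw [← ContinuousLinearMap.coe_coe, LinearMap.pi_apply_eq_sum_univ f.toLinearMap x]; rfl⟩
  obtain ⟨y, hyb, hyq, hyc⟩ := exists_int_solution_of_homogeneous hN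
    (fun i (j : Option (Fin n)) => j.elim (-1) (v i))
    (by rintro i (_ | k) <;> simp [hN', hv])
    (fun j : Option (Fin n) => j.elim (-1) z)
    ⟨fun j => j.elim u d, fun i => by
      have := hfu _ (subset_convexHull ℝ _ ⟨i, rfl⟩)
      rw [hd] at this
      simp only [dotProduct, Fintype.sum_option, Option.elim] at this ⊢
      push_cast; linarith, by
      rw [hd] at huf
      simp only [dotProduct, Fintype.sum_option, Option.elim] at huf ⊢
      linarith⟩
  refine ⟨fun k => y (some k), fun k => by simpa using hyb (some k), fun i => ?_⟩
  have h1 := hyq i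
  simp only [dotProduct, Fintype.sum_option, Option.elim] at h1 hyc ⊢
  push_cast at h1
  simp only [mul_comm (y (some _) : ℝ)]
  linarith

open scoped MatrixOrder Matrix.Norms.L2Operator in
theorem Matrix.PosDef.exists_eq_transpose_mul_self {m : Type*} [Fintype m] [DecidableEq m]
    {Q : Matrix m m ℝ} (hQ : Q.PosDef) : ∃ B : Matrix m m ℝ, IsUnit B.det ∧ Q = Bᵀ * B := by
  obtain ⟨B, hB⟩ := CStarAlgebra.nonneg_iff_eq_star_mul_self.mp hQ.posSemidef.nonneg
  rw [Matrix.star_eq_conjTranspose, Matrix.conjTranspose_eq_transpose_of_trivial] at hB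
  refine ⟨B, ?_, hB⟩
  have h := (Matrix.isUnit_iff_isUnit_det _).1 hQ.isUnit
  rw [hB, Matrix.det_mul] at h
  exact isUnit_of_mul_isUnit_right h

theorem neg_sum_abs_mul_le_dotProduct_mulVec {m : Type*} [Fintype m] (M : Matrix m m ℝ)
    (x : m → ℝ) : -(∑ k, ∑ l, |M k l|) * (x ⬝ᵥ x) ≤ x ⬝ᵥ M *ᵥ x := by
  have hx : ∀ k, x k ^ 2 ≤ x ⬝ᵥ x := fun k => by
    rw [sq]
    exact Finset.single_le_sum (f := fun k => x k * x k) (fun k _ => mul_self_nonneg _)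
      (Finset.mem_univ k)
  generalize x ⬝ᵥ x = S at hx ⊢
  rw [neg_mul, Finset.sum_mul, ← Finset.sum_neg_distrib]
  refine Finset.sum_le_sum fun k _ => ?_
  rw [Matrix.mulVec, dotProduct, Finset.mul_sum, Finset.sum_mul, ← Finset.sum_neg_distrib]
  refine Finset.sum_le_sum fun l _ => ?_
  have h1 : |x k * x l| ≤ S := by
    rw [abs_mul]
    nlinarith [hx k, hx l, sq_abs (x k), sq_abs (x l), sq_nonneg (|x k| - |x l|)]
  have h2 : |M k l * (x k * x l)| ≤ |M k l| * (S) := by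
    rw [abs_mul]; exact mul_le_mul_of_nonneg_left h1 (abs_nonneg _)
  calc _ ≤ M k l * (x k * x l) := (abs_le.1 h2).1
    _ = _ := by ring

theorem Matrix.PosDef.exists_smul_add_nonneg {m : Type*} [Fintype m]
    {Q : Matrix m m ℝ} (hQ : Q.PosDef) (M : Matrix m m ℝ) :
    ∃ t : ℝ, ∀ x, 0 ≤ x ⬝ᵥ (t • Q + M) *ᵥ x := by
  classical
  obtain ⟨B, hB, rfl⟩ := hQ.exists_eq_transpose_mul_self
  refine ⟨∑ k, ∑ l, |(B⁻¹ᵀ * M * B⁻¹) k l|, fun x => ?_⟩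
  have h := neg_sum_abs_mul_le_dotProduct_mulVec (B⁻¹ᵀ * M * B⁻¹) (B *ᵥ x)
  have hB2 : ∀ w, (B *ᵥ x) ⬝ᵥ w = x ⬝ᵥ Bᵀ *ᵥ w := fun w => by
    rw [Matrix.dotProduct_mulVec, Matrix.vecMul_transpose]
  have h1 : (B *ᵥ x) ⬝ᵥ (B⁻¹ᵀ * M * B⁻¹) *ᵥ (B *ᵥ x) = x ⬝ᵥ M *ᵥ x := by
    rw [hB2, Matrix.mulVec_mulVec, Matrix.mulVec_mulVec]
    congr 2
    rw [Matrix.mul_assoc, Matrix.mul_assoc, Matrix.nonsing_inv_mul _ hB, Matrix.mul_one,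
      ← Matrix.mul_assoc, ← Matrix.transpose_mul, Matrix.nonsing_inv_mul _ hB,
      Matrix.transpose_one, Matrix.one_mul]
  have h2 : (B *ᵥ x) ⬝ᵥ (B *ᵥ x) = x ⬝ᵥ (Bᵀ * B) *ᵥ x := by
    rw [hB2, Matrix.mulVec_mulVec]
  rw [Matrix.add_mulVec, dotProduct_add, Matrix.smul_mulVec, dotProduct_smul, smul_eq_mul]
  rw [h1, h2] at h
  linarith

/-- A linear functional that is nonnegative on the positive semidefinite members of a subspace
containing a positive definite matrix is represented by a positive semidefinite matrix. -/
theorem exists_posSemidef_trace_mul_eq {ι m : Type*} [Fintype ι] [Fintype m]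
    {V : ι → Matrix m m ℝ} (hV : ∀ i, (V i).IsHermitian) (hpd : (∑ i, V i).PosDef) (φ : ι → ℝ)
    (hφ : ∀ c : ι → ℝ, (∑ i, c i • V i).PosSemidef → 0 ≤ ∑ i, c i * φ i) :
    ∃ U : Matrix m m ℝ, U.PosSemidef ∧ ∀ i, (U * V i).trace = φ i := by
  classical
  let Ψ : (ι → ℝ) →ₗ[ℝ] Matrix m m ℝ := Fintype.linearCombination ℝ V
  let Φ : (ι → ℝ) →ₗ[ℝ] ℝ := Fintype.linearCombination ℝ φ
  have hΨ : ∀ c, Ψ c = ∑ i, c i • V i := fun c => rfl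
  have hΦ : ∀ c, Φ c = ∑ i, c i * φ i := fun c => rfl
  have hker : Φ ∈ LinearMap.range Ψ.dualMap := by
    rw [LinearMap.range_dualMap_eq_dualAnnihilator_ker, Submodule.mem_dualAnnihilator]
    intro c hc
    rw [LinearMap.mem_ker] at hc
    refine le_antisymm ?_ ?_
    · have := hφ (-c) (by rw [← hΨ, map_neg, hc, neg_zero]; exact .zero)
      rw [← hΦ, map_neg] at this
      linarith
    · have := hφ c (by rw [← hΨ, hc]; exact .zero)
      rwa [← hΦ] at this
  obtain ⟨G, hG⟩ := hker
  have hG' : ∀ c, G (Ψ c) = Φ c := fun c => by rw [← hG]; rfl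
  let s : PointedCone ℝ (Matrix m m ℝ) :=
    { carrier := {M | ∀ x, 0 ≤ x ⬝ᵥ M *ᵥ x}
      add_mem' := fun {A B} hA hB x => by
        rw [Matrix.add_mulVec, dotProduct_add]; exact add_nonneg (hA x) (hB x)
      zero_mem' := fun x => by simp
      smul_mem' := fun c A hA x => by
        change 0 ≤ x ⬝ᵥ (c.1 • A) *ᵥ x
        rw [Matrix.smul_mulVec, dotProduct_smul]
        exact mul_nonneg c.2 (hA x) }
  have hs : ∀ M, M ∈ s ↔ ∀ x, 0 ≤ x ⬝ᵥ M *ᵥ x := fun M => Iff.rfl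
  have hΨh : ∀ c, (Ψ c).IsHermitian := fun c => by
    rw [hΨ, Matrix.IsHermitian, Matrix.conjTranspose_sum]
    refine Finset.sum_congr rfl fun i _ => ?_
    rw [Matrix.conjTranspose_smul, star_trivial, hV i]
  obtain ⟨g, hgf, hgs⟩ := riesz_extension s ⟨LinearMap.range Ψ, G.domRestrict _⟩
    (by
      rintro ⟨_, c, rfl⟩ hc
      change 0 ≤ G (Ψ c)
      rw [hG', hΦ]
      exact hφ c (.of_dotProduct_mulVec_nonneg (hΨh c) hc))
    (by
      intro y
      obtain ⟨t, ht⟩ := hpd.exists_smul_add_nonneg y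
      exact ⟨⟨Ψ fun _ => t, _, rfl⟩, by
        change Ψ (fun _ => t) + y ∈ s
        rw [hΨ, ← Finset.smul_sum]; exact ht⟩)
  have hgV : ∀ i, g (V i) = φ i := fun i => by
    have h1 : Ψ (Pi.single i 1) = V i := by simp [hΨ, Pi.single_apply, ite_smul]
    have h2 : g (Ψ (Pi.single i 1)) = G (Ψ (Pi.single i 1)) := hgf ⟨_, _, rfl⟩
    rw [hG', h1] at h2
    rw [h2, hΦ]; simp [Pi.single_apply]
  let U : Matrix m m ℝ := Matrix.of fun k l => g (Matrix.single k l 1)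
  have hUg : ∀ M : Matrix m m ℝ, (∑ k, ∑ l, U k l * M k l) = g M := by
    intro M
    conv_rhs => rw [Matrix.matrix_eq_sum_single M]
    simp only [map_sum]
    refine Finset.sum_congr rfl fun k _ => Finset.sum_congr rfl fun l _ => ?_
    have : Matrix.single k l (M k l) = M k l • Matrix.single k l (1 : ℝ) := by
      rw [Matrix.smul_single, smul_eq_mul, mul_one]
    rw [this, map_smul, smul_eq_mul, mul_comm]; rfl
  have hUs : ∀ k l, U l k = U k l := by
    intro k l
    have hz : ∀ x : m → ℝ, x ⬝ᵥ (Matrix.single k l (1 : ℝ) - Matrix.single l k 1) *ᵥ x = 0 := by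
      intro x
      rw [Matrix.sub_mulVec, dotProduct_sub, Matrix.single_mulVec, Matrix.single_mulVec]
      simp [dotProduct, Function.update_apply, mul_comm]
    have h1 := hgs (Matrix.single k l (1 : ℝ) - Matrix.single l k 1) fun x => (hz x).ge
    have h2 := hgs (-(Matrix.single k l (1 : ℝ) - Matrix.single l k 1)) fun x => by
      rw [Matrix.neg_mulVec, dotProduct_neg, hz, neg_zero]
    rw [map_neg, map_sub] at h2
    rw [map_sub] at h1
    change g _ = g _
    linarith
  refine ⟨U, .of_dotProduct_mulVec_nonneg ?_ fun x => ?_, fun i => ?_⟩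
  · ext k l; simpa using hUs k l
  · have h1 := hgs (Matrix.vecMulVec x x) fun y => by
      rw [Matrix.vecMulVec_mulVec]
      simp only [MulOpposite.smul_eq_mul_unop, dotProduct_smul, MulOpposite.unop_op]
      rw [dotProduct_comm x y]; exact mul_self_nonneg _
    rw [← hUg] at h1
    refine h1.trans_eq ?_
    simp only [star_trivial, dotProduct, Matrix.mulVec, Finset.mul_sum, Matrix.vecMulVec_apply]
    refine Finset.sum_congr rfl fun k _ => Finset.sum_congr rfl fun l _ => by ring
  · rw [← hgV i, ← hUg]
    simp only [Matrix.trace, Matrix.diag_apply, Matrix.mul_apply]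
    rw [Finset.sum_comm]
    refine Finset.sum_congr rfl fun k _ => Finset.sum_congr rfl fun l _ => ?_
    rw [hUs]

theorem convex_sdpEF {n r m : ℕ} (a : Fin m → (Fin n → ℝ)) (U : Fin m → Matrix (Fin r) (Fin r) ℝ)
    (b : Fin m → ℝ) :
    Convex ℝ {x : Fin n → ℝ | ∃ Y : Matrix (Fin r) (Fin r) ℝ, Y.PosSemidef ∧
      ∀ i, a i ⬝ᵥ x + (U i * Y).trace = b i} := by
  rintro x ⟨X, hX, hx⟩ y ⟨Y, hY, hy⟩ s t hs ht hst
  refine ⟨s • X + t • Y, (hX.smul hs).add (hY.smul ht), fun i => ?_⟩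
  rw [dotProduct_add, dotProduct_smul, dotProduct_smul, Matrix.mul_add, Matrix.mul_smul,
    Matrix.mul_smul, Matrix.trace_add, Matrix.trace_smul, Matrix.trace_smul]
  simp only [smul_eq_mul]
  linear_combination s * hx i + t * hy i + b i * hst

theorem hasSdpEF_convexHull_range {n s : ℕ} (p : Fin s → Fin n → ℝ) :
    HasSdpEF (convexHull ℝ (Set.range p)) s := by
  classical
  let N : ℝ := ∑ k, ∑ j, |p k j|
  have hN : ∀ k j, p k j ≤ N := fun k j => by
    refine (le_abs_self _).trans ?_
    refine (Finset.single_le_sum (f := fun j => |p k j|) (fun _ _ => abs_nonneg _)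
      (Finset.mem_univ j)).trans ?_
    exact Finset.single_le_sum (f := fun k => ∑ j, |p k j|)
      (fun _ _ => Finset.sum_nonneg fun _ _ => abs_nonneg _) (Finset.mem_univ k)
  have htr : ∀ j (Y : Matrix (Fin s) (Fin s) ℝ),
      (Matrix.diagonal (fun k => N - p k j) * Y).trace = ∑ k, (N - p k j) * Y k k := fun j Y => by
    simp [Matrix.trace]
  refine ⟨n + 1, Fin.cons 0 fun j => Pi.single j 1,
    Fin.cons 1 fun j => Matrix.diagonal fun k => N - p k j, Fin.cons 1 fun _ => N, ?_, ?_⟩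
  · refine Fin.cases ?_ fun j => ?_
    · exact .one
    · exact .diagonal fun k => sub_nonneg.2 (hN k j)
  · apply subset_antisymm
    · refine convexHull_min ?_ (convex_sdpEF _ _ _)
      rintro _ ⟨k, rfl⟩
      refine ⟨Matrix.diagonal (Pi.single k 1), .diagonal ?_, Fin.cases ?_ fun j => ?_⟩
      · intro i; by_cases h : i = k <;> simp [h]
      · simp
      · simp only [Fin.cons_succ, single_dotProduct, htr]
        simp [Pi.single_apply]
    · rintro x ⟨Y, hY, hx⟩
      have h0 : ∑ k, Y k k = 1 := by simpa [Matrix.trace] using hx 0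
      have hj : ∀ j, x j = ∑ k, Y k k * p k j := fun j => by
        have := hx j.succ
        simp only [Fin.cons_succ, single_dotProduct, htr, one_mul, sub_mul,
          Finset.sum_sub_distrib, ← Finset.mul_sum, h0] at this
        simp only [mul_comm (Y _ _)]
        linarith
      have : x = ∑ k, Y k k • p k := by ext j; simp [hj]
      rw [this]
      exact (convex_convexHull ℝ _).sum_mem (fun k _ => hY.diag_nonneg) h0
        fun k _ => subset_convexHull ℝ _ ⟨k, rfl⟩

theorem hasSdpEF_xcs {n : ℕ} {s : Set (Fin n → ℝ)} (hs : s.Finite) :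
    HasSdpEF (convexHull ℝ s) (xcs (convexHull ℝ s)) := by
  obtain ⟨k, p, -, rfl⟩ := hs.fin_param
  exact Nat.sInf_mem (s := {r | HasSdpEF (convexHull ℝ (Set.range p)) r})
    ⟨_, hasSdpEF_convexHull_range p⟩

/-- A positive semidefinite matrix with a kernel vector `w`, `w k ≠ 0`, is recovered from its
principal submatrix avoiding the index `k`. -/
theorem eq_conj_submatrix_of_mulVec_eq_zero {r : ℕ} {V : Matrix (Fin (r + 1)) (Fin (r + 1)) ℝ}
    (hV : V.IsHermitian) {w : Fin (r + 1) → ℝ} (hw : V *ᵥ w = 0) {k : Fin (r + 1)}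
    (hk : w k ≠ 0) :
    let P : Matrix (Fin r) (Fin (r + 1)) ℝ := Matrix.of fun i j =>
      (if k.succAbove i = j then 1 else 0) - if j = k then w (k.succAbove i) / w k else 0
    Pᵀ * V.submatrix k.succAbove k.succAbove * P = V := by
  intro P
  have hs : ∀ i j, V j i = V i j := fun i j => by simpa using congrFun (congrFun hV i) j
  have hrow : ∀ i, ∑ j, V i (k.succAbove j) * w (k.succAbove j) = -V i k * w k := fun i => by
    have := congrFun hw i
    rw [Matrix.mulVec, dotProduct, Fin.sum_univ_succAbove _ k, Pi.zero_apply] at this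
    linarith
  have hVP : ∀ i j, ∑ l, V i (k.succAbove l) * P l j = V i j := by
    intro i j
    rcases Fin.eq_self_or_eq_succAbove k j with rfl | ⟨j, rfl⟩
    · simp only [P, Matrix.of_apply, Fin.succAbove_ne, if_false, if_true, zero_sub, mul_neg,
        Finset.sum_neg_distrib, ← mul_div_assoc, ← Finset.sum_div, hrow]
      field_simp
    · simp [P, Fin.succAbove_ne]
  ext i j
  rw [Matrix.mul_assoc, Matrix.mul_apply]
  simp only [Matrix.mul_apply, Matrix.submatrix_apply, hVP, Matrix.transpose_apply]
  rw [← hs i j, ← hVP j i]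
  exact Finset.sum_congr rfl fun l _ => by rw [hs, mul_comm]

theorem HasSdpEF.pred_of_common_kernel {n r m : ℕ} {s : Set (Fin n → ℝ)}
    {a : Fin m → (Fin n → ℝ)} {U : Fin m → Matrix (Fin (r + 1)) (Fin (r + 1)) ℝ} {b : Fin m → ℝ}
    (hU : ∀ i, (U i).PosSemidef)
    (hK : convexHull ℝ s = {x | ∃ Y : Matrix (Fin (r + 1)) (Fin (r + 1)) ℝ, Y.PosSemidef ∧
      ∀ i, a i ⬝ᵥ x + (U i * Y).trace = b i})
    {w : Fin (r + 1) → ℝ} (hw : w ≠ 0)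
    (hs : ∀ x ∈ s, ∃ Y : Matrix (Fin (r + 1)) (Fin (r + 1)) ℝ, Y.PosSemidef ∧
      (∀ i, a i ⬝ᵥ x + (U i * Y).trace = b i) ∧ Y *ᵥ w = 0) :
    HasSdpEF (convexHull ℝ s) r := by
  obtain ⟨k, hk⟩ := Function.ne_iff.1 hw
  let P : Matrix (Fin r) (Fin (r + 1)) ℝ := Matrix.of fun i j =>
      (if k.succAbove i = j then 1 else 0) - if j = k then w (k.succAbove i) / w k else 0
  have htr : ∀ i (Y : Matrix (Fin r) (Fin r) ℝ),
      (P * U i * Pᵀ * Y).trace = (U i * (Pᵀ * Y * P)).trace := fun i Y => by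
    rw [Matrix.mul_assoc, Matrix.mul_assoc, Matrix.trace_mul_comm]
    simp only [Matrix.mul_assoc]
  refine ⟨m, a, fun i => P * U i * Pᵀ, b, fun i => ?_, ?_⟩
  · simpa using (hU i).mul_mul_conjTranspose_same P
  · apply subset_antisymm
    · refine convexHull_min (fun x hx => ?_) (convex_sdpEF _ _ _)
      obtain ⟨Y, hY, hYx, hYw⟩ := hs x hx
      refine ⟨_, hY.submatrix k.succAbove, fun i => ?_⟩
      rw [htr, eq_conj_submatrix_of_mulVec_eq_zero hY.isHermitian hYw hk]
      exact hYx i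
    · rw [hK]
      rintro x ⟨Y, hY, hYx⟩
      refine ⟨Pᵀ * Y * P, by simpa using hY.conjTranspose_mul_mul_same P, fun i => ?_⟩
      rw [← htr]; exact hYx i

/-- Positive semidefinite factorization of the slacks of a polytope, with a strictly feasible
combination of the factors. -/
theorem exists_slack_factorization {n : ℕ} {ι : Type*} [Fintype ι] [Nonempty ι]
    (p : ι → Fin n → ℝ) {r : ℕ} (hr : r = xcs (convexHull ℝ (Set.range p))) :
    ∃ V : ι → Matrix (Fin r) (Fin r) ℝ, (∀ i, (V i).PosSemidef) ∧ (∑ i, V i).PosDef ∧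
      ∀ (a : Fin n → ℝ) (β : ℝ), (∀ i, a ⬝ᵥ p i ≤ β) → (∃ i, a ⬝ᵥ p i = β) →
        ∃ U : Matrix (Fin r) (Fin r) ℝ, U.PosSemidef ∧ ∀ i, (U * V i).trace = β - a ⬝ᵥ p i := by
  classical
  obtain ⟨m, A, W, b, hW, hK⟩ : HasSdpEF (convexHull ℝ (Set.range p)) r :=
    hr ▸ hasSdpEF_xcs (Set.finite_range p)
  have hmem : ∀ i, ∃ Y : Matrix (Fin r) (Fin r) ℝ, Y.PosSemidef ∧
      ∀ j, A j ⬝ᵥ p i + (W j * Y).trace = b j := fun i => by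
    have : p i ∈ convexHull ℝ (Set.range p) := subset_convexHull ℝ _ ⟨i, rfl⟩
    rwa [hK] at this
  choose V hV hVp using hmem
  have hsum : (∑ i, V i).PosSemidef := Matrix.posSemidef_sum _ fun i _ => hV i
  have hpd : (∑ i, V i).PosDef := by
    by_contra hnot
    obtain ⟨w, hw0, hw⟩ : ∃ w, w ≠ 0 ∧ (∑ i, V i) *ᵥ w = 0 := by
      rw [hsum.posDef_iff_isUnit, Matrix.isUnit_iff_isUnit_det, isUnit_iff_ne_zero, not_not,
        ← Matrix.exists_mulVec_eq_zero_iff] at hnot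
      exact hnot
    have hVw : ∀ i, V i *ᵥ w = 0 := fun i => by
      rw [← (hV i).dotProduct_mulVec_zero_iff]
      have h1 := congrArg (fun y => star w ⬝ᵥ y) hw
      simp only [Matrix.sum_mulVec, dotProduct_sum, dotProduct_zero] at h1
      exact (Finset.sum_eq_zero_iff_of_nonneg fun i _ => (hV i).dotProduct_mulVec_nonneg w).1 h1 i
        (Finset.mem_univ i)
    obtain _ | r := r
    · exact hw0 (Subsingleton.elim _ _)
    · have := HasSdpEF.pred_of_common_kernel hW hK hw0 (by
        rintro _ ⟨i, rfl⟩
        exact ⟨V i, hV i, hVp i, hVw i⟩)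
      have h2 : xcs (convexHull ℝ (Set.range p)) ≤ r := Nat.sInf_le this
      omega
  refine ⟨V, hV, hpd, fun a β hβ ⟨i₀, hi₀⟩ =>
    exists_posSemidef_trace_mul_eq (fun i => (hV i).isHermitian) hpd _ fun c hc => ?_⟩
  -- Adding a multiple of the tight vertex makes the coefficient sum positive.
  let t : ℝ := |∑ i, c i| + 1
  let d : ι → ℝ := c + Pi.single i₀ t
  let S : ℝ := ∑ i, d i
  have hS : S = ∑ i, c i + t := by simp [S, d, Finset.sum_add_distrib]
  have hSpos : 0 < S := by rw [hS]; have := neg_abs_le (∑ i, c i); simp only [t]; linarith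
  have hdV : ∑ i, d i • V i = ∑ i, c i • V i + t • V i₀ := by
    simp [d, add_smul, Finset.sum_add_distrib, Pi.single_apply, ite_smul]
  have ht : 0 ≤ t := by positivity
  have hx : (S⁻¹ • ∑ i, d i • p i) ∈ convexHull ℝ (Set.range p) := by
    rw [hK]
    refine ⟨S⁻¹ • ∑ i, d i • V i, ?_, fun j => ?_⟩
    · rw [hdV]; exact (hc.add ((hV i₀).smul ht)).smul (by positivity)
    · have h1 : ∑ i, d i * (A j ⬝ᵥ p i + (W j * V i).trace) = S * b j := by
        simp only [hVp, ← Finset.sum_mul, S]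
      simp only [dotProduct_smul, Matrix.mul_smul, Matrix.trace_smul, dotProduct_sum,
        Matrix.mul_sum, Matrix.trace_sum, smul_eq_mul]
      rw [← mul_add, ← Finset.sum_add_distrib]
      simp only [← mul_add, h1]
      field_simp
  have hle : a ⬝ᵥ (S⁻¹ • ∑ i, d i • p i) ≤ β := by
    have hcv : Convex ℝ {x : Fin n → ℝ | a ⬝ᵥ x ≤ β} :=
      convex_halfSpace_le ⟨dotProduct_add a, fun c x => dotProduct_smul c a x⟩ β
    exact convexHull_min (by rintro _ ⟨i, rfl⟩; exact hβ i) hcv hx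
  rw [dotProduct_smul, dotProduct_sum, smul_eq_mul, inv_mul_le_iff₀ hSpos] at hle
  simp only [dotProduct_smul, smul_eq_mul] at hle
  have h2 : ∑ i, d i * (β - a ⬝ᵥ p i) = ∑ i, c i * (β - a ⬝ᵥ p i) := by
    simp [d, add_mul, Finset.sum_add_distrib, Pi.single_apply, hi₀]
  rw [← h2]
  simp only [mul_sub, Finset.sum_sub_distrib, ← Finset.sum_mul]
  linarith
/-- A determinant maximizer `Q` over the convex hull of the `V i` satisfies the first-order
optimality conditions `Tr (Q⁻¹ * V i) ≤ card m`. -/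
theorem exists_posDef_trace_inv_mul_le {ι m : Type*} [Fintype ι] [Nonempty ι] [Fintype m]
    [DecidableEq m] {V : ι → Matrix m m ℝ} (hV : ∀ i, (V i).PosSemidef)
    (hpd : (∑ i, V i).PosDef) :
    ∃ Q ∈ convexHull ℝ (Set.range V), Q.PosDef ∧ ∀ i, (Q⁻¹ * V i).trace ≤ Fintype.card m := by
  have hcard : (0 : ℝ) < Fintype.card ι := by exact_mod_cast Fintype.card_pos
  have hpsd : ∀ Q ∈ convexHull ℝ (Set.range V), Q.PosSemidef := fun Q hQ =>
    convexHull_min (s := Set.range V) (t := {Q | Q.PosSemidef}) (by rintro _ ⟨i, rfl⟩; exact hV i)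
      (fun A hA B hB s t hs ht _ =>
        Matrix.PosSemidef.add (Matrix.PosSemidef.smul hA hs) (Matrix.PosSemidef.smul hB ht)) hQ
  have hmem : (Fintype.card ι : ℝ)⁻¹ • ∑ i, V i ∈ convexHull ℝ (Set.range V) := by
    rw [Finset.smul_sum]
    exact (convex_convexHull ℝ _).sum_mem (fun _ _ => by positivity) (by simp)
      fun i _ => subset_convexHull ℝ _ ⟨i, rfl⟩
  obtain ⟨Q, hQ, hmax⟩ := ((Set.finite_range V).isCompact_convexHull ℝ).exists_isMaxOn
    ⟨_, hmem⟩ (f := Matrix.det) (Continuous.continuousOn (by fun_prop))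
  have hdet : 0 < Q.det := lt_of_lt_of_le (hpd.smul (inv_pos.2 hcard)).det_pos (hmax hmem)
  have hQu : IsUnit Q.det := hdet.ne'.isUnit
  refine ⟨Q, hQ, (hpsd Q hQ).posDef_iff_det_ne_zero.2 hdet.ne', fun i => ?_⟩
  let M : Matrix m m ℝ := Q⁻¹ * V i - 1
  have hle : ∀ t : ℝ, 0 < t → t ≤ 1 → (1 + t • M).det ≤ 1 := fun t ht0 ht1 => by
    have h1 : (1 - t) • Q + t • V i ∈ convexHull ℝ (Set.range V) :=
      convex_convexHull ℝ _ hQ (subset_convexHull ℝ _ ⟨i, rfl⟩) (by linarith) ht0.le (by ring)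
    have h2 : (1 - t) • Q + t • V i = Q * (1 + t • M) := by
      simp only [M, Matrix.mul_add, Matrix.mul_smul, Matrix.mul_sub, Matrix.mul_one,
        Matrix.mul_nonsing_inv_cancel_left _ _ hQu]
      module
    have h3 := hmax h1
    simp only [Set.mem_ofPred_eq] at h3
    rw [h2, Matrix.det_mul] at h3
    exact le_of_mul_le_mul_left (by simpa using h3) hdet
  let q : Polynomial ℝ := (1 + (Polynomial.X : Polynomial ℝ) • M.map Polynomial.C).det.divX.divX
  have hlim : Filter.Tendsto (fun t : ℝ => M.trace + q.eval t * t) (nhdsWithin 0 (Set.Ioi 0))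
      (nhds M.trace) := by
    have : Continuous fun t : ℝ => M.trace + q.eval t * t := by fun_prop
    simpa using (this.tendsto 0).mono_left nhdsWithin_le_nhds
  have htr : M.trace ≤ 0 := by
    refine le_of_tendsto hlim ?_
    filter_upwards [Ioc_mem_nhdsGT (zero_lt_one (α := ℝ))] with t ht
    have h := hle t ht.1 ht.2
    rw [Matrix.det_one_add_smul] at h
    have h' : t * (M.trace + q.eval t * t) ≤ t * 0 := by simp only [q]; linarith
    exact le_of_mul_le_mul_left h' ht.1
  simp only [M, Matrix.trace_sub, Matrix.trace_one] at htr
  linarith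

/-- Slack factorization whose factors all have trace at most `√(rD)`, where `D` bounds the
slacks. -/
theorem exists_balanced_slack_factorization {n : ℕ} {ι : Type*} [Fintype ι] [Nonempty ι]
    (p : ι → Fin n → ℝ) {r : ℕ} (hr : r = xcs (convexHull ℝ (Set.range p))) (hr0 : 0 < r)
    {D : ℝ} (hD : 0 < D) :
    ∃ V : ι → Matrix (Fin r) (Fin r) ℝ, (∀ i, (V i).PosSemidef) ∧
      (∀ i, (V i).trace ≤ Real.sqrt (r * D)) ∧
      ∀ (a : Fin n → ℝ) (β : ℝ), (∀ i, a ⬝ᵥ p i ≤ β) → (∃ i, a ⬝ᵥ p i = β) →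
        (∀ i, β - a ⬝ᵥ p i ≤ D) →
        ∃ U : Matrix (Fin r) (Fin r) ℝ, U.PosSemidef ∧ U.trace ≤ Real.sqrt (r * D) ∧
          ∀ i, (V i * U).trace = β - a ⬝ᵥ p i := by
  obtain ⟨V, hV, hpd, hfac⟩ := exists_slack_factorization p hr
  obtain ⟨Q, hQ, hQpd, hQtr⟩ := exists_posDef_trace_inv_mul_le hV hpd
  obtain ⟨B, hB, rfl⟩ := hQpd.exists_eq_transpose_mul_self
  have hr' : (0 : ℝ) < r := by exact_mod_cast hr0
  set s := Real.sqrt (r * D) with hs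
  have hs0 : 0 < s := Real.sqrt_pos.2 (by positivity)
  have hss : s * s = r * D := Real.mul_self_sqrt (by positivity)
  refine ⟨fun i => (s / r) • (B⁻¹ᵀ * V i * B⁻¹), fun i => ?_, fun i => ?_,
    fun a β hβ htight hslack => ?_⟩
  · exact (by simpa using (hV i).conjTranspose_mul_mul_same B⁻¹ :
      (B⁻¹ᵀ * V i * B⁻¹).PosSemidef).smul (by positivity)
  · have h1 := hQtr i
    rw [Matrix.mul_inv_rev, Matrix.mul_assoc, Matrix.trace_mul_comm, ← Matrix.transpose_nonsing_inv,
      Fintype.card_fin] at h1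
    rw [Matrix.trace_smul, smul_eq_mul]
    calc s / r * _ ≤ s / r * r := by gcongr
      _ = s := by field_simp
  · obtain ⟨U, hU, hUV⟩ := hfac a β hβ htight
    have hUQ : (U * (Bᵀ * B)).trace ≤ D := by
      have hcv : Convex ℝ {Y : Matrix (Fin r) (Fin r) ℝ | (U * Y).trace ≤ D} :=
        convex_halfSpace_le ⟨fun x y => by rw [Matrix.mul_add, Matrix.trace_add],
          fun c x => by rw [Matrix.mul_smul, Matrix.trace_smul]⟩ D
      refine convexHull_min ?_ hcv hQ
      rintro _ ⟨i, rfl⟩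
      exact (hUV i).trans_le (hslack i)
    refine ⟨(r / s) • (B * U * Bᵀ), ?_, ?_, fun i => ?_⟩
    · exact (by simpa using hU.mul_mul_conjTranspose_same B :
        (B * U * Bᵀ).PosSemidef).smul (by positivity)
    · rw [Matrix.trace_smul, smul_eq_mul, Matrix.mul_assoc, Matrix.trace_mul_comm, Matrix.mul_assoc]
      calc r / s * _ ≤ r / s * D := by gcongr
        _ = s := by field_simp; linarith
    · have h1 : Bᵀ * B⁻¹ᵀ = 1 := by
        rw [← Matrix.transpose_mul, Matrix.nonsing_inv_mul _ hB, Matrix.transpose_one]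
      have h2 : (B⁻¹ᵀ * V i * B⁻¹ * (B * U * Bᵀ)).trace = (U * V i).trace := by
        calc _ = (B⁻¹ᵀ * (V i * (B⁻¹ * B) * U * Bᵀ)).trace := by simp only [Matrix.mul_assoc]
          _ = (V i * U * (Bᵀ * B⁻¹ᵀ)).trace := by
            rw [Matrix.nonsing_inv_mul _ hB, Matrix.mul_one, Matrix.trace_mul_comm]
            simp only [Matrix.mul_assoc]
          _ = _ := by rw [h1, Matrix.mul_one, Matrix.trace_mul_comm]
      rw [Matrix.smul_mul, Matrix.mul_smul, smul_smul, Matrix.trace_smul, h2, hUV, smul_eq_mul]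
      field_simp

theorem factorial_succ_le_pow (n : ℕ) : (n + 1).factorial ≤ (n + 1) ^ n := by
  induction n with
  | zero => simp
  | succ n ih =>
    rw [Nat.factorial_succ, pow_succ']
    exact Nat.mul_le_mul_left _ (ih.trans (Nat.pow_le_pow_left (by omega) n))

theorem four_mul_factorial_mul_pow_le {n N : ℕ} (hn : 2 ≤ n) (hN : 1 ≤ N) :
    4 * n * N * ((n + 1).factorial * N ^ (n + 1)) ≤ ((n + 1) * N) ^ (2 * n) := by
  have h1 : 4 * n ≤ (n + 1) ^ n := by
    calc 4 * n ≤ (n + 1) ^ 2 := by nlinarith [mul_self_nonneg ((n : ℤ) - 1)]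
      _ ≤ (n + 1) ^ n := Nat.pow_le_pow_right (by omega) hn
  calc _ = (4 * n) * (n + 1).factorial * N ^ (n + 2) := by ring
    _ ≤ (n + 1) ^ n * (n + 1) ^ n * N ^ (2 * n) := by
      gcongr
      · exact factorial_succ_le_pow n
      · omega
    _ = _ := by rw [mul_pow]; ring

theorem abs_dotProduct_le {n : ℕ} {a x : Fin n → ℝ} {A N : ℝ} (ha : ∀ k, |a k| ≤ A)
    (hx : ∀ k, |x k| ≤ N) : |a ⬝ᵥ x| ≤ n * N * A := by
  refine (Finset.abs_sum_le_sum_abs _ _).trans ?_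
  calc ∑ k, |a k * x k| ≤ ∑ _k : Fin n, A * N := Finset.sum_le_sum fun k _ => by
        rw [abs_mul]
        exact mul_le_mul (ha k) (hx k) (abs_nonneg _) ((abs_nonneg _).trans (ha k))
    _ = _ := by simp; ring

theorem finite_integralPoint_box (n N : ℕ) :
    {x : Fin n → ℝ | IsIntegralPoint x ∧ ∀ k, |x k| ≤ (N : ℝ)}.Finite := by
  refine ((Set.finite_Icc (fun _ : Fin n => -(N : ℤ)) fun _ => (N : ℤ)).image
    fun v k => (v k : ℝ)).subset ?_
  rintro x ⟨hx, hb⟩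
  choose v hv using hx
  refine ⟨v, ⟨fun k => ?_, fun k => ?_⟩, funext fun k => (hv k).symm⟩ <;>
  · have := abs_le.1 (hb k)
    rw [hv] at this
    first | exact_mod_cast this.1 | exact_mod_cast this.2

open scoped MatrixOrder Matrix.Norms.L2Operator in
theorem Matrix.PosSemidef.trace_mul_nonneg {m : Type*} [Fintype m] [DecidableEq m]
    {A B : Matrix m m ℝ} (hA : A.PosSemidef) (hB : B.PosSemidef) : 0 ≤ (A * B).trace := by
  obtain ⟨C, rfl⟩ := CStarAlgebra.nonneg_iff_eq_star_mul_self.1 hA.nonneg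
  rw [Matrix.star_eq_conjTranspose, Matrix.mul_assoc, Matrix.trace_mul_comm]
  exact (hB.mul_mul_conjTranspose_same C).trace_nonneg

theorem intCast_dotProduct {n : ℕ} (a x : Fin n → ℤ) :
    ((a ⬝ᵥ x : ℤ) : ℝ) = (fun k => (a k : ℝ)) ⬝ᵥ fun k => (x k : ℝ) := by
  simp [dotProduct]

theorem rounding_constants {r n : ℕ} {Δ δ D : ℝ} (hr0 : 0 < r) (hn : 2 ≤ n) (hΔ : 1 ≤ Δ)
    (hD0 : 0 < D) (hD : 2 * D ≤ Δ) (hδ0 : 0 < δ)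
    (hδ : δ ≤ (16 * (r : ℝ) ^ 3 * ((n : ℝ) + (r : ℝ) ^ 2))⁻¹) :
    Real.sqrt (r * Δ) * (2 * (r : ℝ) ^ 2 * (δ / Δ)) ≤ 1 / (8 * ((n : ℝ) + (r : ℝ) ^ 2)) ∧
      Real.sqrt (r * D) + 2 * (r : ℝ) ^ 2 * (δ / Δ) ≤ Real.sqrt (r * Δ) ∧
      Real.sqrt (r * D) ≤ Real.sqrt (r * Δ) ∧
      Real.sqrt (r * Δ) ≤ 8 * (r : ℝ) ^ ((3 : ℝ) / 2) * Δ := by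
  have hr1 : (1 : ℝ) ≤ r := by exact_mod_cast hr0
  have hn2 : (2 : ℝ) ≤ n := by exact_mod_cast hn
  have hS1 : 1 ≤ Real.sqrt (r * Δ) := Real.one_le_sqrt.2 (by nlinarith)
  have hSS : Real.sqrt (r * Δ) ^ 2 = r * Δ := Real.sq_sqrt (by positivity)
  have hss : Real.sqrt (r * D) ^ 2 = r * D := Real.sq_sqrt (by positivity)
  have hle : Real.sqrt (r * D) ≤ Real.sqrt (r * Δ) :=
    Real.sqrt_le_sqrt (mul_le_mul_of_nonneg_left (by linarith) (by positivity))
  have h1 : Real.sqrt (r * Δ) * (2 * (r : ℝ) ^ 2 * (δ / Δ)) ≤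
      1 / (8 * ((n : ℝ) + (r : ℝ) ^ 2)) := by
    calc _ ≤ Real.sqrt (r * Δ) ^ 2 * (2 * (r : ℝ) ^ 2 * (δ / Δ)) := by
          gcongr
          nlinarith
      _ = 2 * (r : ℝ) ^ 3 * δ := by rw [hSS]; field_simp
      _ ≤ 2 * (r : ℝ) ^ 3 * (16 * (r : ℝ) ^ 3 * ((n : ℝ) + (r : ℝ) ^ 2))⁻¹ := by gcongr
      _ = _ := by field_simp; norm_num
  refine ⟨h1, ?_, hle, ?_⟩
  · have h2 : 2 * (r : ℝ) ^ 2 * (δ / Δ) ≤ 1 / 8 := by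
      calc _ ≤ Real.sqrt (r * Δ) * (2 * (r : ℝ) ^ 2 * (δ / Δ)) :=
            le_mul_of_one_le_left (by positivity) hS1
        _ ≤ 1 / (8 * ((n : ℝ) + (r : ℝ) ^ 2)) := h1
        _ ≤ 1 / 8 := one_div_le_one_div_of_le (by norm_num) (by nlinarith)
    have h3 : Real.sqrt (r * D) + 1 / 8 ≤ Real.sqrt (r * Δ) := by
      refine le_of_sq_le_sq ?_ (by positivity)
      nlinarith [Real.sqrt_nonneg (r * D)]
    linarith
  · rw [Real.sqrt_mul (by positivity)]
    have h4 : Real.sqrt r ≤ (r : ℝ) ^ ((3 : ℝ) / 2) := by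
      rw [Real.sqrt_eq_rpow]
      exact Real.rpow_le_rpow_of_exponent_le hr1 (by norm_num)
    have h5 : Real.sqrt Δ ≤ Δ := Real.sqrt_le_iff.2 ⟨by positivity, by nlinarith⟩
    calc _ ≤ (r : ℝ) ^ ((3 : ℝ) / 2) * Δ := by gcongr
      _ ≤ _ := by nlinarith [show 0 ≤ (r : ℝ) ^ ((3 : ℝ) / 2) * Δ by positivity]

theorem abs_trace_mul_gridRound_sub_le {r : ℕ} {g c : ℝ} (hg : 0 < g)
    {Y U : Matrix (Fin r) (Fin r) ℝ} (hc : 0 ≤ c) (hY : opNorm Y ≤ c) :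
    |(Y * gridRound g U).trace - (Y * U).trace| ≤ c * (2 * (r : ℝ) ^ 2 * g) := by
  rw [← Matrix.trace_sub, ← Matrix.mul_sub]
  exact (abs_trace_mul_le Y _ hY).trans
    (mul_le_mul_of_nonneg_left (sum_abs_gridRound_sub_le hg U) hc)

/-- Lemma 5.1 (Generalized rounding lemma): with `n, N ≥ 2`,
`Δ = ((n+1)N)^{2n}`, `𝒱 ⊆ ℤⁿ ∩ [−N,N]ⁿ` nonempty and convex independent,
`𝒳 = conv(𝒱) ∩ ℤⁿ`, `r = xcs(conv 𝒳)` and `0 < δ ≤ (16r³(n+r²))⁻¹`, there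
exist integer data `(a_i, b_i)` bounded by `Δ` and PSD matrices `U_i` of
operator norm at most `√(rΔ)`, entries integer multiples of `δ/Δ` of absolute
value at most `8r^{3/2}Δ`, such that `𝒳` is exactly the set of integer points
admitting `Y ∈ S₊^r`, `‖Y‖ ≤ √(rΔ)`, with
`|b_i − a_iᵀx − Tr(Y U_i)| ≤ 1/(4(n+r²))` for all `i`. -/
theorem generalized_rounding_lemma {n N : ℕ} (hn : 2 ≤ n) (hN : 2 ≤ N)
    (Δ : ℝ) (hΔ : Δ = ((((n : ℝ) + 1) * N) ^ (2 * n)))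
    (𝒱 : Set (Fin n → ℝ)) (h𝒱ne : 𝒱.Nonempty)
    (h𝒱int : ∀ v ∈ 𝒱, IsIntegralPoint v)
    (h𝒱box : ∀ v ∈ 𝒱, ∀ k, |v k| ≤ (N : ℝ))
    (h𝒱ci : ∀ v ∈ 𝒱, v ∉ convexHull ℝ (𝒱 \ {v}))
    (𝒳 : Set (Fin n → ℝ)) (h𝒳 : 𝒳 = convexHull ℝ 𝒱 ∩ {x | IsIntegralPoint x})
    (r : ℕ) (hr : r = xcs (convexHull ℝ 𝒳))
    (δ : ℝ) (hδ0 : 0 < δ) (hδ : δ ≤ (16 * (r : ℝ) ^ 3 * ((n : ℝ) + (r : ℝ) ^ 2))⁻¹) :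
    ∃ (a : Fin (n + r ^ 2) → (Fin n → ℤ)) (b : Fin (n + r ^ 2) → ℤ)
      (U : Fin (n + r ^ 2) → Matrix (Fin r) (Fin r) ℝ),
      (∀ i k, (|a i k| : ℝ) ≤ Δ) ∧
      (∀ i, (|b i| : ℝ) ≤ Δ) ∧
      (∀ i, (U i).PosSemidef) ∧
      (∀ i, opNorm (U i) ≤ Real.sqrt (r * Δ)) ∧
      (∀ i k l, ∃ m : ℤ, U i k l = (m : ℝ) * (δ / Δ)) ∧
      (∀ i k l, |U i k l| ≤ 8 * (r : ℝ) ^ ((3 : ℝ) / 2) * Δ) ∧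
      𝒳 = {x | IsIntegralPoint x ∧
            ∃ Y : Matrix (Fin r) (Fin r) ℝ, Y.PosSemidef ∧ opNorm Y ≤ Real.sqrt (r * Δ) ∧
              ∀ i, |(b i : ℝ) - (fun k => (a i k : ℝ)) ⬝ᵥ x - (Y * U i).trace| ≤
                1 / (4 * ((n : ℝ) + (r : ℝ) ^ 2))} := by
  have hr0 : 0 < r := by
    rcases Nat.eq_zero_or_pos r with h | h
    · simp [h] at hδ
      linarith
    · exact h
  have hbox : ∀ x ∈ convexHull ℝ 𝒱, ∀ k, |x k| ≤ (N : ℝ) := by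
    have hsub : convexHull ℝ 𝒱 ⊆ Set.Icc (fun _ => -(N : ℝ)) fun _ => (N : ℝ) :=
      convexHull_min (fun v hv => ⟨fun k => (abs_le.1 (h𝒱box v hv k)).1,
        fun k => (abs_le.1 (h𝒱box v hv k)).2⟩) (convex_Icc _ _)
    exact fun x hx k => abs_le.2 ⟨(hsub hx).1 k, (hsub hx).2 k⟩
  have h𝒳mem : ∀ x, x ∈ 𝒳 ↔ x ∈ convexHull ℝ 𝒱 ∧ IsIntegralPoint x := by simp [h𝒳]
  have hfin : Finite 𝒳 := ((finite_integralPoint_box n N).subset fun x hx =>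
    ⟨((h𝒳mem x).1 hx).2, hbox x ((h𝒳mem x).1 hx).1⟩).to_subtype
  have : Fintype 𝒳 := Fintype.ofFinite _
  have hne : Nonempty 𝒳 := by
    obtain ⟨v, hv⟩ := h𝒱ne
    exact ⟨v, (h𝒳mem v).2 ⟨subset_convexHull ℝ _ hv, h𝒱int v hv⟩⟩
  have hhull : ∀ z ∈ convexHull ℝ 𝒳, IsIntegralPoint z → z ∈ 𝒳 := fun z hz hi =>
    (h𝒳mem z).2 ⟨convexHull_min (fun x hx => ((h𝒳mem x).1 hx).1) (convex_convexHull ℝ 𝒱) hz, hi⟩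
  have hlift : ∀ x : 𝒳, ∃ v : Fin n → ℤ, (x : Fin n → ℝ) = fun k => (v k : ℝ) := fun x => by
    choose v hv using ((h𝒳mem x).1 x.2).2
    exact ⟨v, funext hv⟩
  choose v hv using hlift
  have hvbox : ∀ i k, |v i k| ≤ (N : ℤ) := fun i k => by
    have := hbox _ ((h𝒳mem i).1 i.2).1 k
    simp only [hv] at this
    exact_mod_cast this
  have hrange : Set.range (fun (i : 𝒳) k => (v i k : ℝ)) = 𝒳 := by
    have h : (fun (i : 𝒳) k => (v i k : ℝ)) = Subtype.val := funext fun i => (hv i).symm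
    rw [h, Subtype.range_coe]
  set A : ℕ := (n + 1).factorial * N ^ (n + 1) with hA
  have hA1 : 1 ≤ A := Nat.mul_pos (Nat.factorial_pos _) (by positivity)
  set D : ℝ := 2 * n * N * A with hD
  have hnR : (2 : ℝ) ≤ n := by exact_mod_cast hn
  have hNR : (2 : ℝ) ≤ N := by exact_mod_cast hN
  have hAR : (1 : ℝ) ≤ A := by exact_mod_cast hA1
  have hD0 : 0 < D := by positivity
  have hDΔ : 2 * D ≤ Δ := by
    have := four_mul_factorial_mul_pow_le hn (show 1 ≤ N by omega)
    rw [← hA] at this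
    have h : ((4 * n * N * A : ℕ) : ℝ) ≤ (((n + 1) * N) ^ (2 * n) : ℕ) := by exact_mod_cast this
    push_cast at h
    rw [hΔ, hD]
    linarith
  have hAnN : (A : ℝ) ≤ n * N * A := le_mul_of_one_le_left (by positivity) (by nlinarith)
  have hΔ1 : 1 ≤ Δ := by rw [hD] at hDΔ; linarith
  have hr' : r = xcs (convexHull ℝ (Set.range fun (i : 𝒳) k => (v i k : ℝ))) := by
    rw [hrange, hr]
  obtain ⟨V, hVpsd, hVtr, hV⟩ := exists_balanced_slack_factorization _ hr' hr0 hD0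
  let I : Set (Fin n → ℤ) := Set.Icc (fun _ => -(A : ℤ)) fun _ => (A : ℤ)
  have hI : ∀ a ∈ I, ∀ k, |((a k : ℤ) : ℝ)| ≤ A := fun a ha k => by
    have := abs_le.2 ⟨ha.1 k, ha.2 k⟩
    exact_mod_cast this
  have : Finite I := (Set.finite_Icc _ _).to_subtype
  have : Nonempty I := ⟨0, fun k => by simp, fun k => by simp⟩
  have hvR : ∀ i k, |((v i k : ℤ) : ℝ)| ≤ N := fun i k => by exact_mod_cast hvbox i k
  have hex : ∀ a : I, ∃ (β : ℤ) (U : Matrix (Fin r) (Fin r) ℝ), |(β : ℝ)| ≤ n * N * A ∧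
      (∃ i, (a : Fin n → ℤ) ⬝ᵥ v i = β) ∧ U.PosSemidef ∧ U.trace ≤ Real.sqrt (r * D) ∧
      ∀ i, (V i * U).trace =
        β - (fun k => ((a : Fin n → ℤ) k : ℝ)) ⬝ᵥ fun k => (v i k : ℝ) := fun a => by
    obtain ⟨i, hi⟩ := Finite.exists_max fun i => (a : Fin n → ℤ) ⬝ᵥ v i
    have hb : ∀ j, |(fun k => ((a : Fin n → ℤ) k : ℝ)) ⬝ᵥ fun k => (v j k : ℝ)| ≤ n * N * A :=
      fun j => abs_dotProduct_le (hI a a.2) (hvR j)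
    obtain ⟨U, hU, hUtr, hUV⟩ := hV (fun k => ((a : Fin n → ℤ) k : ℝ))
      (((a : Fin n → ℤ) ⬝ᵥ v i : ℤ) : ℝ)
      (fun j => by rw [← intCast_dotProduct]; exact_mod_cast hi j)
      ⟨i, (intCast_dotProduct _ _).symm⟩
      (fun j => by
        rw [intCast_dotProduct, hD]
        linarith [(abs_le.1 (hb i)).2, (abs_le.1 (hb j)).1])
    exact ⟨_, U, by rw [intCast_dotProduct]; exact hb i, ⟨i, rfl⟩, hU, hUtr, hUV⟩
  choose β U hβ hβmax hU hUtr hUV using hex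
  obtain ⟨σ, hσ⟩ := exists_bounded_spanning_selection (d := n + r ^ 2)
    (E := (Fin n → ℝ) × Matrix (Fin r) (Fin r) ℝ)
    (by simp [Module.finrank_matrix, sq])
    fun a : I => ((fun k => ((a : Fin n → ℤ) k : ℝ)), U a)
  obtain ⟨hround, hsum, hle, hentry⟩ := rounding_constants hr0 hn hΔ1 hD0 hDΔ hδ0 hδ
  have hg : 0 < δ / Δ := by positivity
  have hUnorm : ∀ i, opNorm (gridRound (δ / Δ) (U (σ i))) ≤ Real.sqrt (r * Δ) := fun i =>
    calc _ ≤ (gridRound (δ / Δ) (U (σ i))).trace := ((hU (σ i)).gridRound hg).opNorm_le_trace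
      _ ≤ _ := (trace_gridRound_le hg _).trans
        ((add_le_add_left (hUtr (σ i)) _).trans hsum)
  have hm : 0 < (n : ℝ) + (r : ℝ) ^ 2 := by positivity
  refine ⟨fun i => (σ i : Fin n → ℤ), fun i => β (σ i), fun i => gridRound (δ / Δ) (U (σ i)),
    fun i k => ?_, fun i => ?_, fun i => (hU (σ i)).gridRound hg, hUnorm,
    fun i k l => ⟨_, rfl⟩, fun i k l => ((abs_entry_le_opNorm _ k l).trans (hUnorm i)).trans hentry,
    Set.Subset.antisymm (fun x hx => ?_) ?_⟩
  · have := hI _ (σ i).2 k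
    rw [hD] at hDΔ
    linarith
  · have := hβ (σ i)
    rw [hD] at hDΔ
    linarith
  · refine ⟨((h𝒳mem x).1 hx).2, V ⟨x, hx⟩, hVpsd _,
      ((hVpsd _).opNorm_le_trace.trans (hVtr _)).trans hle, fun i => ?_⟩
    have h := abs_trace_mul_gridRound_sub_le hg (U := U (σ i)) (Real.sqrt_nonneg _)
      (((hVpsd ⟨x, hx⟩).opNorm_le_trace.trans (hVtr _)).trans hle)
    rw [hUV, ← hv ⟨x, hx⟩, abs_sub_comm] at h
    refine (h.trans hround).trans (one_div_le_one_div_of_le (by positivity) (by linarith))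
  · rintro x ⟨hx, Y, hY, hYn, hYi⟩
    by_contra hx𝒳
    obtain ⟨a, haA, ha⟩ := exists_int_separator (show 1 ≤ N by omega) v hvbox
      (z := x) (by rw [hrange]; exact fun h => hx𝒳 (hhull x h hx))
    have haI : a ∈ I := by
      have : ∀ k, |a k| ≤ (A : ℤ) := fun k => by rw [hA]; exact_mod_cast haA k
      exact ⟨fun k => (abs_le.1 (this k)).1, fun k => (abs_le.1 (this k)).2⟩
    obtain ⟨c, hc, hcw⟩ := hσ ⟨a, haI⟩
    have hdot : ∀ y : Fin n → ℝ, (fun k => (a k : ℝ)) ⬝ᵥ y =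
        ∑ i, c i * ((fun k => ((σ i : Fin n → ℤ) k : ℝ)) ⬝ᵥ y) := fun y => by
      have h := congrArg (fun w => w ⬝ᵥ y) (congrArg Prod.fst hcw)
      simpa [Prod.fst_sum, sum_dotProduct] using h
    have htr : ∀ Z : Matrix (Fin r) (Fin r) ℝ, (Z * U ⟨a, haI⟩).trace =
        ∑ i, c i * (Z * U (σ i)).trace := fun Z => by
      have h := congrArg (fun w => (Z * w).trace) (congrArg Prod.snd hcw)
      simpa [Prod.snd_sum, Matrix.mul_sum, Matrix.trace_sum] using h
    have hβc : (β ⟨a, haI⟩ : ℝ) = ∑ i, c i * β (σ i) := by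
      obtain ⟨i₀⟩ := hne
      have h1 := hUV ⟨a, haI⟩ i₀
      rw [htr, hdot] at h1
      rw [← sub_add_cancel (β ⟨a, haI⟩ : ℝ) (∑ i, c i * _), ← h1, ← Finset.sum_add_distrib]
      refine Finset.sum_congr rfl fun i _ => ?_
      rw [hUV]
      ring
    have hgap : (β ⟨a, haI⟩ : ℝ) + 1 ≤ (fun k => (a k : ℝ)) ⬝ᵥ x := by
      choose z hz using hx
      obtain ⟨i, hi⟩ := hβmax ⟨a, haI⟩
      have h := ha i
      rw [show x = fun k => (z k : ℝ) from funext hz, ← intCast_dotProduct,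
        ← intCast_dotProduct, show a ⬝ᵥ v i = _ from hi] at h
      rw [show x = fun k => (z k : ℝ) from funext hz, ← intCast_dotProduct]
      exact_mod_cast h
    have hterm : ∀ i, |(β (σ i) : ℝ) - (fun k => ((σ i : Fin n → ℤ) k : ℝ)) ⬝ᵥ x -
        (Y * U (σ i)).trace| ≤ 3 / 8 / ((n : ℝ) + (r : ℝ) ^ 2) := fun i => by
      have h := abs_trace_mul_gridRound_sub_le hg (U := U (σ i)) (Real.sqrt_nonneg _) hYn
      have h1 := (abs_add_le _ _).trans (add_le_add (hYi i) (h.trans hround))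
      rw [sub_add_sub_cancel] at h1
      refine h1.trans (le_of_eq ?_)
      field_simp
      norm_num
    have htotal : |(β ⟨a, haI⟩ : ℝ) - (fun k => (a k : ℝ)) ⬝ᵥ x - (Y * U ⟨a, haI⟩).trace| ≤
        3 / 8 := by
      rw [hβc, hdot, htr, ← Finset.sum_sub_distrib, ← Finset.sum_sub_distrib]
      refine (Finset.abs_sum_le_sum_abs _ _).trans ?_
      calc _ ≤ ∑ _i : Fin (n + r ^ 2), 3 / 8 / ((n : ℝ) + (r : ℝ) ^ 2) :=
            Finset.sum_le_sum fun i _ => by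
              rw [← mul_sub, ← mul_sub, abs_mul]
              exact (mul_le_of_le_one_left (abs_nonneg _) (hc i)).trans (hterm i)
        _ = 3 / 8 := by
            simp
            field_simp
    linarith [(abs_le.1 htotal).1, hY.trace_mul_nonneg (hU ⟨a, haI⟩)]
end

section
/- There exists a constant c > 0 such that for every integer d ≥ 3 there exists a convex polygon P ⊆ ℝ² with exactly d vertices, all of whose vertices are integer points lying in {1,…,2d} × {1,…,4d²}, whose semidefinite extension complexity satisfies xcs(P) ≥ c · (d / log₂ d)^{1/4}. -/
open Matrix

theorem trace_vecMulVec_mul_self {m : Type*} [Fintype m] (v : m → ℝ) (M : Matrix m m ℝ) :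
    (vecMulVec v v * M).trace = v ⬝ᵥ M *ᵥ v := by
  rw [vecMulVec_mul, trace_vecMulVec, dotProduct_comm, dotProduct_mulVec, dotProduct_comm]

open scoped MatrixOrder Matrix.Norms.L2Operator in
theorem exists_eq_conjTranspose_mul_self {m : Type*} [Fintype m] {M : Matrix m m ℝ}
    (hM : M.PosSemidef) : ∃ B : Matrix m m ℝ, M = Bᴴ * B := by
  classical
  exact CStarAlgebra.nonneg_iff_eq_star_mul_self.1 hM.nonneg

theorem trace_mul_nonneg {m : Type*} [Fintype m] {U W : Matrix m m ℝ}
    (hU : U.PosSemidef) (hW : W.PosSemidef) : 0 ≤ (U * W).trace := by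
  classical
  obtain ⟨B, rfl⟩ := exists_eq_conjTranspose_mul_self hW
  rw [← Matrix.mul_assoc, Matrix.trace_mul_comm, ← Matrix.mul_assoc]
  exact (hU.mul_mul_conjTranspose_same B).trace_nonneg

theorem exists_posSemidef_approx {ι m : Type*} [Fintype ι] [Fintype m] (W : ι → Matrix m m ℝ)
    (hW : ∀ i, (W i).PosSemidef) (g : ι → ℝ)
    (hg : ∀ c : ι → ℝ, (∑ i, c i • W i).PosSemidef → 0 ≤ ∑ i, c i * g i) {ε : ℝ} (hε : 0 < ε) :
    ∃ U : Matrix m m ℝ, U.PosSemidef ∧ ∀ i, |(U * W i).trace - g i| ≤ ε := by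
  classical
  let C : Set (ι → ℝ) := {y | ∃ U : Matrix m m ℝ, U.PosSemidef ∧ y = fun i => (U * W i).trace}
  have hC : Convex ℝ C := by
    rintro _ ⟨U, hU, rfl⟩ _ ⟨U', hU', rfl⟩ a b ha hb -
    refine ⟨a • U + b • U', (hU.smul ha).add (hU'.smul hb), ?_⟩
    funext i
    simp [Matrix.add_mul]
  have hmem : g ∈ closure C := by
    by_contra hgC
    obtain ⟨f, u, hf, hu⟩ := geometric_hahn_banach_closed_point hC.closure isClosed_closure hgC
    have hf0 : 0 < u := by
      simpa using hf 0 (subset_closure ⟨0, .zero, by funext i; simp⟩)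
    have hfC : ∀ U : Matrix m m ℝ, U.PosSemidef → f (fun i => (U * W i).trace) ≤ 0 := by
      intro U hU
      by_contra! hpos
      set z := f (fun i => (U * W i).trace) with hz
      have := hf (fun i => (((u / z) • U) * W i).trace)
        (subset_closure ⟨_, hU.smul (by positivity), rfl⟩)
      have he : (fun i => (((u / z) • U) * W i).trace) = (u / z) • fun i => (U * W i).trace := by
        funext i; simp
      rw [he, map_smul, ← hz, smul_eq_mul, div_mul_cancel₀ _ hpos.ne'] at this
      exact lt_irrefl _ this
    have hrep : ∀ y : ι → ℝ, f y = ∑ i, f (Pi.single i 1) * y i := by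
      intro y
      conv_lhs => rw [pi_eq_sum_univ' y, map_sum]
      refine Finset.sum_congr rfl fun i _ => ?_
      rw [map_smul, smul_eq_mul, mul_comm]
    have := hg (fun i => - f (Pi.single i 1)) ?_
    · simp only [neg_mul, Finset.sum_neg_distrib, ← hrep] at this
      linarith
    · refine Matrix.PosSemidef.of_dotProduct_mulVec_nonneg ?_ fun v => ?_
      · refine isSelfAdjoint_sum _ fun i _ => ?_
        exact IsSelfAdjoint.smul (by simp [IsSelfAdjoint]) (hW i).isHermitian
      · have := hfC _ (Matrix.posSemidef_vecMulVec_self_star v)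
        rw [hrep] at this
        simp only [star_trivial, trace_vecMulVec_mul_self] at this ⊢
        rw [Matrix.sum_mulVec, dotProduct_sum]
        simp only [smul_mulVec, dotProduct_smul, smul_eq_mul, neg_mul, Finset.sum_neg_distrib]
        linarith
  obtain ⟨_, ⟨U, hU, rfl⟩, hd⟩ := Metric.mem_closure_iff.1 hmem ε hε
  refine ⟨U, hU, fun i => ?_⟩
  have := (dist_le_pi_dist _ _ i).trans hd.le
  rwa [dist_comm, Real.dist_eq] at this

theorem abs_apply_le_of_diag_le {m : Type*} [Fintype m] {U : Matrix m m ℝ}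
    (hU : U.PosSemidef) {D : ℝ} (hD : ∀ a, U a a ≤ D) (a b : m) : |U a b| ≤ D := by
  classical
  have hs : U b a = U a b := by simpa using hU.isHermitian.apply a b
  have h1 := hU.dotProduct_mulVec_nonneg (Pi.single a 1 + Pi.single b 1)
  have h2 := hU.dotProduct_mulVec_nonneg (Pi.single a 1 - Pi.single b 1)
  simp [mulVec_add, mulVec_sub] at h1 h2
  have := hD a
  have := hD b
  rw [abs_le]
  constructor <;> linarith

theorem exists_bounded_spanning {ι E : Type*} [Finite ι] [Nonempty ι] [AddCommGroup E]
    [Module ℝ E] [FiniteDimensional ℝ E] (v : ι → E) {n : ℕ} (hn : Module.finrank ℝ E ≤ n) :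
    ∃ k : Fin n → ι, ∀ i, ∃ c : Fin n → ℝ, (∀ l, |c l| ≤ 1) ∧ v i = ∑ l, c l • v (k l) := by
  classical
  set W := Submodule.span ℝ (Set.range v) with hW
  obtain ⟨q, rfl⟩ := Nat.exists_eq_add_of_le ((Submodule.finrank_le W).trans hn)
  let w : ι → W := fun i => ⟨v i, Submodule.subset_span ⟨i, rfl⟩⟩
  let e := Module.finBasis ℝ W
  obtain ⟨f, hf⟩ := Finite.exists_max (fun f : Fin (Module.finrank ℝ W) → ι => |e.det (w ∘ f)|)
  have hne : e.det (w ∘ f) ≠ 0 := by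
    obtain ⟨g, hg, -, hli⟩ := Submodule.exists_fun_fin_finrank_span_eq ℝ (Set.range v)
    choose h hh using hg
    have hli' : LinearIndependent ℝ (w ∘ h) := by
      refine LinearIndependent.of_comp W.subtype ?_
      have hgh : g = W.subtype ∘ (w ∘ h) := by
        funext i
        exact (hh i).symm
      exact hgh ▸ hli
    have := (Module.Basis.is_basis_iff_det e).1 ⟨hli', hli'.span_eq_top_of_card_eq_finrank' (Fintype.card_fin _)⟩
    intro h0
    have h1 := hf h
    rw [h0, abs_zero] at h1
    exact this.ne_zero (abs_nonpos_iff.1 h1)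
  obtain ⟨hli, hsp⟩ := (Module.Basis.is_basis_iff_det e).2 (isUnit_iff_ne_zero.2 hne)
  let B := Module.Basis.mk hli hsp.ge
  refine ⟨Fin.append f fun _ => Classical.arbitrary ι, fun i =>
    ⟨Fin.append (fun l => B.coord l (w i)) 0, fun l => ?_, ?_⟩⟩
  · refine Fin.addCases (fun l => ?_) (fun l => ?_) l
    · rw [Fin.append_left]
      have h1 := e.det_smul_mk_coord_eq_det_update hli hsp.ge l
      have h2 := LinearMap.congr_fun h1 (w i)
      have h3 := hf (Function.update f l i)
      rw [Function.comp_update] at h3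
      simp only [LinearMap.smul_apply, smul_eq_mul, MultilinearMap.toLinearMap_apply] at h2
      change _ = e.det _ at h2
      rw [← h2, abs_mul] at h3
      exact le_of_mul_le_mul_left (h3.trans (mul_one _).ge) (abs_pos.2 hne)
    · simp
  · have := congrArg (Subtype.val) (B.sum_repr (w i))
    simp only [Submodule.coe_sum] at this
    rw [Fin.sum_univ_add]
    simp only [Fin.append_left, Fin.append_right]
    simpa [B, w] using this.symm

theorem exists_bounded_factorization {ι κ m : Type*} [Finite ι] [Nonempty ι] [Fintype m]
    [Nonempty m] {n : ℕ} (hn : Fintype.card m ≤ n) (W : ι → Matrix m m ℝ) (U : κ → Matrix m m ℝ)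
    (hW : ∀ i, (W i).PosSemidef) (hU : ∀ j, (U j).PosSemidef) {D : ℝ}
    (hD : ∀ i j, (U j * W i).trace ≤ D) :
    ∃ (W' : ι → Matrix (Fin n) (Fin n) ℝ) (U' : κ → Matrix (Fin n) (Fin n) ℝ),
      (∀ i, (W' i).PosSemidef) ∧ (∀ j, (U' j).PosSemidef) ∧
      (∀ i j, (U' j * W' i).trace = (U j * W i).trace) ∧
      (∀ i a b, |W' i a b| ≤ n) ∧ ∀ j a b, |U' j a b| ≤ D := by
  classical
  choose B hB using fun i => exists_eq_conjTranspose_mul_self (hW i)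
  obtain ⟨k, hk⟩ := exists_bounded_spanning (fun p : ι × m => B p.1 p.2) (n := n) (by simpa using hn)
  choose c hc hck using hk
  let T : Matrix (Fin n) m ℝ := .of fun l => B (k l).1 (k l).2
  let C : ι → Matrix m (Fin n) ℝ := fun i => .of fun a => c (i, a)
  have hBC : ∀ i, B i = C i * T := by
    intro i
    ext a b
    have := congrFun (hck (i, a)) b
    simpa [Matrix.mul_apply, C, T] using this
  have hUT : ∀ j, (T * U j * Tᴴ).PosSemidef := fun j => (hU j).mul_mul_conjTranspose_same T
  refine ⟨fun i => (C i)ᴴ * C i, fun j => T * U j * Tᴴ,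
    fun i => Matrix.posSemidef_conjTranspose_mul_self _, hUT, ?_, ?_, fun j => ?_⟩
  · intro i j
    rw [hB i, hBC i, Matrix.conjTranspose_mul, Matrix.trace_mul_comm (U j)]
    rw [Matrix.trace_mul_comm]
    simp only [Matrix.mul_assoc]
    rw [Matrix.trace_mul_comm Tᴴ]
    simp only [Matrix.mul_assoc]
  · intro i a b
    have hn' : (Fintype.card m : ℝ) ≤ n := by exact_mod_cast hn
    refine le_trans ?_ hn'
    simp only [Matrix.mul_apply]
    refine (Finset.abs_sum_le_sum_abs _ _).trans ?_
    calc _ ≤ ∑ _x : m, (1 : ℝ) := Finset.sum_le_sum fun x _ => by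
            rw [abs_mul]
            exact mul_le_one₀ (by simpa [C] using hc (i, x) a) (abs_nonneg _) (hc (i, x) b)
      _ = _ := by simp
  · refine abs_apply_le_of_diag_le (hUT j) fun l => ?_
    refine le_trans ?_ (hD (k l).1 j)
    have h1 := (hU j).mul_mul_conjTranspose_same (B (k l).1)
    have h2 : (U j * W (k l).1).trace = (B (k l).1 * U j * (B (k l).1)ᴴ).trace := by
      rw [hB, ← Matrix.mul_assoc, Matrix.trace_mul_comm, Matrix.mul_assoc]
    rw [h2, Matrix.trace]
    refine le_trans (le_of_eq ?_) (Finset.single_le_sum (fun a _ => h1.diag_nonneg (i := a))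
      (Finset.mem_univ (k l).2))
    simp [Matrix.mul_apply, T]

theorem HasSdpEF.exists_lift {n r : ℕ} {K : Set (Fin n → ℝ)} (h : HasSdpEF K r) {ι : Type*}
    [Fintype ι] (x : ι → Fin n → ℝ) (hx : ∀ i, x i ∈ K) :
    ∃ Y : ι → Matrix (Fin r) (Fin r) ℝ, (∀ i, (Y i).PosSemidef) ∧
      ∀ c : ι → ℝ, ∑ i, c i = 1 → (∑ i, c i • Y i).PosSemidef → ∑ i, c i • x i ∈ K := by
  obtain ⟨m, a, U, b, -, rfl⟩ := h
  choose Y hY hxY using hx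
  refine ⟨Y, hY, fun c hc hcY => ⟨_, hcY, fun l => ?_⟩⟩
  rw [dotProduct_sum, Matrix.mul_sum, Matrix.trace_sum, ← Finset.sum_add_distrib]
  calc _ = ∑ i, c i * b l := Finset.sum_congr rfl fun i _ => by
            rw [← hxY i l]; simp [mul_add]
    _ = b l := by rw [← Finset.sum_mul, hc, one_mul]

theorem nonneg_of_forall_add_mul_nonneg {a b : ℝ} (h : ∀ t : ℝ, 0 ≤ t → 0 ≤ a + t * b) :
    0 ≤ b := by
  by_contra! hb
  have := h ((|a| + 1) / -b) (div_nonneg (by positivity) (by linarith))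
  have h2 : (|a| + 1) / -b * b = -(|a| + 1) := by
    rw [div_neg, neg_mul, div_mul_cancel₀ _ hb.ne]
  rw [h2] at this
  linarith [le_abs_self a]

theorem HasSdpEF.exists_approx_factorization {n r : ℕ} {K : Set (Fin n → ℝ)} (h : HasSdpEF K r)
    {ι : Type*} [Fintype ι] [Nonempty ι] (x : ι → Fin n → ℝ) (hx : ∀ i, x i ∈ K) :
    ∃ W : ι → Matrix (Fin r ⊕ Unit) (Fin r ⊕ Unit) ℝ, (∀ i, (W i).PosSemidef) ∧
      ∀ (a : Fin n → ℝ) (β : ℝ), (∀ y ∈ K, 0 ≤ a ⬝ᵥ y + β) → ∀ ε > 0,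
        ∃ U : Matrix (Fin r ⊕ Unit) (Fin r ⊕ Unit) ℝ, U.PosSemidef ∧
          ∀ i, |(U * W i).trace - (a ⬝ᵥ x i + β)| ≤ ε := by
  classical
  obtain ⟨Y, hY, hYK⟩ := h.exists_lift x hx
  have hW : ∀ i, (Matrix.fromBlocks (Y i) 0 0 (1 : Matrix Unit Unit ℝ)).PosSemidef := by
    intro i
    refine Matrix.PosSemidef.of_dotProduct_mulVec_nonneg ?_ fun v => ?_
    · exact Matrix.IsHermitian.fromBlocks (hY i).isHermitian (by simp) (by simp)
    · have := (hY i).dotProduct_mulVec_nonneg (v ∘ Sum.inl)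
      have h2 := mul_self_nonneg (v (Sum.inr ()))
      simp only [star_trivial, Matrix.fromBlocks_mulVec, dotProduct, Fintype.sum_sum_type] at this ⊢
      simpa using add_nonneg this h2
  refine ⟨fun i => Matrix.fromBlocks (Y i) 0 0 1, hW, fun a β hK ε hε =>
    exists_posSemidef_approx _ hW _ (fun c hc => ?_) hε⟩
  have hcY : (∑ i, c i • Y i).PosSemidef := by
    convert hc.submatrix Sum.inl
    ext p q
    simp [Matrix.sum_apply]
  have hc0 : 0 ≤ ∑ i, c i := by
    have := hc.diag_nonneg (i := Sum.inr ())
    simpa [Matrix.sum_apply] using this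
  obtain ⟨i₀⟩ := ‹Nonempty ι›
  refine nonneg_of_forall_add_mul_nonneg (a := a ⬝ᵥ x i₀ + β) fun t ht => ?_
  set s := 1 + t * ∑ i, c i with hs
  have hspos : 0 < s := by positivity
  let c' : ι → ℝ := fun i => s⁻¹ * ((Pi.single i₀ 1 : ι → ℝ) i + t * c i)
  have hsum : ∀ {E : Type} [AddCommGroup E] [Module ℝ E] (z : ι → E),
      ∑ i, c' i • z i = s⁻¹ • (z i₀ + t • ∑ i, c i • z i) := by
    intro E _ _ z
    simp only [c', mul_smul, add_smul, ← Finset.smul_sum, Finset.sum_add_distrib]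
    simp [Pi.single_apply, ite_smul]
  have h1 : ∑ i, c' i = 1 := by
    have := hsum (fun _ => (1 : ℝ))
    simp only [smul_eq_mul, mul_one] at this
    rw [this, ← hs, inv_mul_cancel₀ hspos.ne']
  have h2 : (∑ i, c' i • Y i).PosSemidef := by
    rw [hsum]
    exact ((hY i₀).add (hcY.smul ht)).smul (by positivity)
  have h3 := hK _ (hYK c' h1 h2)
  have h4 : a ⬝ᵥ (∑ i, c' i • x i) + β = ∑ i, c' i • (a ⬝ᵥ x i + β) := by
    simp only [dotProduct_sum, dotProduct_smul, smul_add, Finset.sum_add_distrib, ← Finset.sum_smul,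
      h1, one_smul]
  rw [h4, hsum] at h3
  exact (mul_nonneg_iff_of_pos_left (inv_pos.2 hspos)).1 h3

theorem hasSdpEF_convexHull {n : ℕ} (V : Finset (Fin n → ℝ)) (hV : ∀ v ∈ V, ∀ l, 0 ≤ v l) :
    HasSdpEF (convexHull ℝ (V : Set (Fin n → ℝ))) V.card := by
  classical
  let p : Fin V.card → (Fin n → ℝ) := fun k => (V.equivFin.symm k : Fin n → ℝ)
  have hp : ∀ k, p k ∈ V := fun k => (V.equivFin.symm k).2
  refine ⟨n + 1, Fin.snoc (fun l => -Pi.single l 1) 0,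
    Fin.snoc (fun l => Matrix.diagonal fun k => p k l) 1, Fin.snoc 0 1, fun i => ?_, ?_⟩
  · refine Fin.lastCases ?_ (fun l => ?_) i
    · rw [Fin.snoc_last]
      exact Matrix.PosSemidef.one
    · rw [Fin.snoc_castSucc]
      exact Matrix.posSemidef_diagonal_iff.2 fun k => hV _ (hp k) l
  · have hdiag : ∀ (u : Fin V.card → ℝ) (Y : Matrix (Fin V.card) (Fin V.card) ℝ),
        (Matrix.diagonal u * Y).trace = ∑ k, u k * Y k k := fun u Y => by
      simp [Matrix.trace, Matrix.diagonal_mul]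
    have hsum : ∀ {E : Type} [AddCommMonoid E] (f : (Fin n → ℝ) → E),
        ∑ y ∈ V, f y = ∑ k, f (p k) := fun f => by
      rw [← Finset.sum_coe_sort]
      exact (V.equivFin.symm.sum_comp fun y => f y).symm
    ext x
    simp only [Set.mem_ofPred_eq, Fin.forall_fin_succ', Fin.snoc_castSucc, Fin.snoc_last, hdiag,
      neg_dotProduct, single_dotProduct, zero_dotProduct, zero_add, one_mul, Pi.zero_apply]
    constructor
    · intro hx
      obtain ⟨w, hw, hw1, rfl⟩ := Finset.mem_convexHull'.1 hx
      refine ⟨Matrix.diagonal fun k => w (p k),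
        Matrix.posSemidef_diagonal_iff.2 fun k => hw _ (hp k), fun l => ?_, ?_⟩
      · simp [hsum, Finset.sum_apply, mul_comm]
      · simpa [Matrix.trace, hsum] using hw1
    · rintro ⟨Y, hY, hYx, hY1⟩
      have hx : x = ∑ k, Y k k • p k := by
        funext l
        have := hYx l
        simp only [Finset.sum_apply, Pi.smul_apply, smul_eq_mul]
        simp only [mul_comm (p _ l)] at this
        linarith
      rw [hx]
      exact (convex_convexHull ℝ _).sum_mem (fun k _ => hY.diag_nonneg) hY1
        fun k _ => subset_convexHull ℝ _ (hp k)

/-- The integer `2k + 1` or `2k + 2`, according to the Boolean paired with `k`. -/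
def pairAbscissa {d : ℕ} (q : Fin d × Bool) : ℕ :=
  2 * q.1 + 1 + q.2.toNat

theorem one_le_pairAbscissa {d : ℕ} (q : Fin d × Bool) : 1 ≤ pairAbscissa q := by
  unfold pairAbscissa; omega

theorem pairAbscissa_le {d : ℕ} (q : Fin d × Bool) : pairAbscissa q ≤ 2 * d := by
  have := q.1.2
  have := q.2.toNat_le
  unfold pairAbscissa; omega

theorem pairAbscissa_injective {d : ℕ} : Function.Injective (pairAbscissa (d := d)) := by
  rintro ⟨k, x⟩ ⟨l, y⟩ h
  have hx := x.toNat_le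
  have hy := y.toNat_le
  simp only [pairAbscissa] at h
  have hkl : k = l := Fin.ext (by omega)
  subst hkl
  have hxy : x.toNat = y.toNat := by omega
  cases x <;> cases y <;> simp_all

/-- The point of the standard parabola with abscissa `N`. -/
def parabolaPoint (N : ℕ) : Fin 2 → ℝ :=
  ![N, (N : ℝ) ^ 2]

theorem parabolaPoint_injective : Function.Injective parabolaPoint := fun M N h => by
  simpa [parabolaPoint] using congrFun h 0

/-- The points of the parabola with abscissae `2k + 1` or `2k + 2` as prescribed by `b k`. -/
noncomputable def parabolaVertices {d : ℕ} (b : Fin d → Bool) : Finset (Fin 2 → ℝ) :=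
  Finset.univ.image fun k => parabolaPoint (pairAbscissa (k, b k))

theorem card_parabolaVertices {d : ℕ} (b : Fin d → Bool) : (parabolaVertices b).card = d := by
  rw [parabolaVertices, Finset.card_image_of_injective, Finset.card_univ, Fintype.card_fin]
  intro k l h
  exact congrArg Prod.fst (pairAbscissa_injective (parabolaPoint_injective h))

theorem mem_parabolaVertices {d : ℕ} {b : Fin d → Bool} {v : Fin 2 → ℝ} :
    v ∈ parabolaVertices b ↔ ∃ k, parabolaPoint (pairAbscissa (k, b k)) = v := by
  simp [parabolaVertices]

theorem nonneg_on_convexHull {n : ℕ} {T : Set (Fin n → ℝ)} {a : Fin n → ℝ} {β : ℝ}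
    (hT : ∀ y ∈ T, 0 ≤ a ⬝ᵥ y + β) : ∀ y ∈ convexHull ℝ T, 0 ≤ a ⬝ᵥ y + β := by
  have hconv : Convex ℝ {y : Fin n → ℝ | -β ≤ a ⬝ᵥ y} :=
    convex_halfSpace_ge ⟨fun x y => dotProduct_add _ _ _, fun c x => dotProduct_smul _ _ _⟩ _
  intro y hy
  have h : -β ≤ a ⬝ᵥ y := convexHull_min (t := {y | -β ≤ a ⬝ᵥ y}) (fun z hz => by
    have := hT z hz
    change -β ≤ a ⬝ᵥ z
    linarith) hconv hy
  linarith

theorem tangent_dotProduct_parabolaPoint (M N : ℕ) :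
    ![-2 * (M : ℝ), 1] ⬝ᵥ parabolaPoint N + ((M : ℝ) ^ 2 - 1 / 2) =
      ((N : ℝ) - M) ^ 2 - 1 / 2 := by
  simp [parabolaPoint, dotProduct, Fin.sum_univ_two]
  ring

theorem tangent_nonneg {M N : ℕ} (h : N ≠ M) : 0 ≤ ((N : ℝ) - M) ^ 2 - 1 / 2 := by
  have h1 : (1 : ℤ) ≤ ((N : ℤ) - M) ^ 2 := by
    have : (N : ℤ) - M ≠ 0 := sub_ne_zero.2 (by exact_mod_cast h)
    have := sq_pos_of_ne_zero this
    omega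
  have h2 : (1 : ℝ) ≤ ((N : ℝ) - M) ^ 2 := by exact_mod_cast h1
  linarith

theorem parabolaVertices_convexIndependent {d : ℕ} (b : Fin d → Bool) {v : Fin 2 → ℝ}
    (hv : v ∈ parabolaVertices b) :
    v ∉ convexHull ℝ ((parabolaVertices b : Set (Fin 2 → ℝ)) \ {v}) := by
  intro hmem
  obtain ⟨k, rfl⟩ := mem_parabolaVertices.1 hv
  set M := pairAbscissa (k, b k)
  have := nonneg_on_convexHull (a := ![-2 * (M : ℝ), 1]) (β := (M : ℝ) ^ 2 - 1 / 2) ?_ _ hmem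
  · rw [tangent_dotProduct_parabolaPoint] at this
    norm_num at this
  · rintro y ⟨hy, hne⟩
    obtain ⟨l, rfl⟩ := mem_parabolaVertices.1 hy
    rw [tangent_dotProduct_parabolaPoint]
    exact tangent_nonneg fun h => hne (by rw [h]; rfl)

theorem tangent_nonneg_on_convexHull {d : ℕ} (b : Fin d → Bool) (j : Fin d) :
    ∀ y ∈ convexHull ℝ (parabolaVertices b : Set (Fin 2 → ℝ)),
      0 ≤ ![-2 * (pairAbscissa (j, !b j) : ℝ), 1] ⬝ᵥ y +
        ((pairAbscissa (j, !b j) : ℝ) ^ 2 - 1 / 2) := by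
  refine nonneg_on_convexHull fun y hy => ?_
  obtain ⟨l, rfl⟩ := mem_parabolaVertices.1 hy
  rw [tangent_dotProduct_parabolaPoint]
  refine tangent_nonneg fun h => ?_
  have := pairAbscissa_injective h
  simp only [Prod.mk.injEq] at this
  obtain ⟨rfl, h2⟩ := this
  simp at h2

theorem parabolaPoint_mem_convexHull {d : ℕ} (b : Fin d → Bool) (k : Fin d) :
    parabolaPoint (pairAbscissa (k, b k)) ∈
      convexHull ℝ (parabolaVertices b : Set (Fin 2 → ℝ)) :=
  subset_convexHull ℝ _ (mem_parabolaVertices.2 ⟨k, rfl⟩)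

theorem exists_bounded_tangent_factorization {d r n : ℕ} (hd : 0 < d) (hn : r + 1 ≤ n)
    {b : Fin d → Bool} (h : HasSdpEF (convexHull ℝ (parabolaVertices b : Set (Fin 2 → ℝ))) r)
    {ε : ℝ} (hε : 0 < ε) (hε' : ε ≤ 1 / 2) :
    ∃ W U : Fin d → Matrix (Fin n) (Fin n) ℝ,
      (∀ i, (W i).PosSemidef) ∧ (∀ j, (U j).PosSemidef) ∧
      (∀ i j, |(U j * W i).trace -
        (((pairAbscissa (i, b i) : ℝ) - pairAbscissa (j, !b j)) ^ 2 - 1 / 2)| ≤ ε) ∧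
      (∀ i p q, |W i p q| ≤ n) ∧ ∀ j p q, |U j p q| ≤ 4 * (d : ℝ) ^ 2 := by
  have : Nonempty (Fin d) := ⟨⟨0, hd⟩⟩
  obtain ⟨W, hW, hWU⟩ := h.exists_approx_factorization _ (parabolaPoint_mem_convexHull b)
  choose U hU hUW using fun j => hWU _ _ (tangent_nonneg_on_convexHull b j) ε hε
  simp only [tangent_dotProduct_parabolaPoint] at hUW
  obtain ⟨W', U', hW', hU', htr, hWb, hUb⟩ := exists_bounded_factorization (n := n)
    (by simpa using hn) W U hW hU (D := 4 * (d : ℝ) ^ 2) fun i j => by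
      have h1 := (abs_le.1 (hUW j i)).2
      have h2 : ((pairAbscissa (i, b i) : ℝ) - pairAbscissa (j, !b j)) ^ 2 ≤ (2 * d) ^ 2 := by
        have a1 : (pairAbscissa (i, b i) : ℝ) ≤ 2 * d := by exact_mod_cast pairAbscissa_le _
        have a2 : (pairAbscissa (j, !b j) : ℝ) ≤ 2 * d := by exact_mod_cast pairAbscissa_le _
        have a3 : (0 : ℝ) ≤ pairAbscissa (i, b i) := Nat.cast_nonneg _
        have a4 : (0 : ℝ) ≤ pairAbscissa (j, !b j) := Nat.cast_nonneg _
        exact sq_le_sq' (by linarith) (by linarith)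
      nlinarith
  exact ⟨W', U', hW', hU', fun i j => by rw [htr]; exact hUW j i, hWb, hUb⟩

theorem abs_trace_mul_le_s17 {n : ℕ} {A W : Matrix (Fin n) (Fin n) ℝ} {δ : ℝ}
    (hA : ∀ p q, |A p q| ≤ δ) (hW : ∀ p q, |W p q| ≤ n) : |(A * W).trace| ≤ n ^ 3 * δ := by
  simp only [Matrix.trace, Matrix.diag_apply, Matrix.mul_apply]
  calc |∑ p, ∑ q, A p q * W q p| ≤ ∑ p, ∑ q, |A p q * W q p| :=
        (Finset.abs_sum_le_sum_abs _ _).trans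
          (Finset.sum_le_sum fun p _ => Finset.abs_sum_le_sum_abs _ _)
    _ ≤ ∑ _p : Fin n, ∑ _q : Fin n, δ * n :=
        Finset.sum_le_sum fun p _ => Finset.sum_le_sum fun q _ => by
          rw [abs_mul]
          exact mul_le_mul (hA p q) (hW q p) (abs_nonneg _) ((abs_nonneg _).trans (hA p q))
    _ = n ^ 3 * δ := by
        simp only [Finset.sum_const, Finset.card_univ, Fintype.card_fin, nsmul_eq_mul]
        ring

theorem exists_bounded_tangent_spanning {d n : ℕ} (hd : 0 < d)
    (U : Fin d → Matrix (Fin n) (Fin n) ℝ) (N : Fin d → ℝ) :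
    ∃ k : Fin (n * n + 3) → Fin d, ∀ j, ∃ c : Fin (n * n + 3) → ℝ, (∀ l, |c l| ≤ 1) ∧
      U j = ∑ l, c l • U (k l) ∧
      ∀ x : ℝ, (x - N j) ^ 2 - 1 / 2 = ∑ l, c l * ((x - N (k l)) ^ 2 - 1 / 2) := by
  have : Nonempty (Fin d) := ⟨⟨0, hd⟩⟩
  obtain ⟨k, hk⟩ := exists_bounded_spanning (n := n * n + 3)
    (fun j => (U j, (![1, N j, N j ^ 2] : Fin 3 → ℝ))) (by simp [Module.finrank_matrix])
  refine ⟨k, fun j => ?_⟩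
  obtain ⟨c, hc, hcj⟩ := hk j
  simp only [Prod.ext_iff, Prod.fst_sum, Prod.snd_sum, Prod.smul_mk] at hcj
  refine ⟨c, hc, hcj.1, fun x => ?_⟩
  have h0 : 1 = ∑ l, c l := by simpa using congrFun hcj.2 0
  have h1 : N j = ∑ l, c l * N (k l) := by simpa using congrFun hcj.2 1
  have h2 : N j ^ 2 = ∑ l, c l * N (k l) ^ 2 := by simpa using congrFun hcj.2 2
  calc (x - N j) ^ 2 - 1 / 2
      = (x ^ 2 - 1 / 2) * ∑ l, c l - 2 * x * ∑ l, c l * N (k l) + ∑ l, c l * N (k l) ^ 2 := by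
        rw [← h0, ← h1, ← h2]
        ring
    _ = _ := by
        rw [Finset.mul_sum, Finset.mul_sum, ← Finset.sum_sub_distrib, ← Finset.sum_add_distrib]
        exact Finset.sum_congr rfl fun l _ => by ring

theorem two_pow_le_of_forall_hasSdpEF {d n : ℕ} (hd : 0 < d) (hn : 0 < n)
    (h : ∀ b : Fin d → Bool, ∃ r, r + 1 ≤ n ∧
      HasSdpEF (convexHull ℝ (parabolaVertices b : Set (Fin 2 → ℝ))) r) :
    2 ^ d ≤ (d * 2 * (2 * (128 * d ^ 2 * n ^ 5) + 1) ^ (n * n)) ^ (n * n + 3) := by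
  classical
  have hn1 : (1 : ℝ) ≤ n := by exact_mod_cast hn
  have hn0 : (0 : ℝ) < n := by linarith
  set M : ℝ := 32 * (n : ℝ) ^ 5 with hM
  have hM0 : 0 < M := by positivity
  set Q : ℕ := 128 * d ^ 2 * n ^ 5 with hQ
  have hε' : 1 / (16 * (n : ℝ) ^ 2) ≤ 1 / 2 :=
    one_div_le_one_div_of_le (by norm_num) (by nlinarith)
  have key := fun b => (h b).elim fun r hr =>
    exists_bounded_tangent_factorization hd hr.1 hr.2 (ε := 1 / (16 * (n : ℝ) ^ 2))
      (by positivity) hε'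
  choose W U hW hU hUW hWb hUb using key
  choose k hk using fun b =>
    exists_bounded_tangent_spanning hd (U b) fun j => (pairAbscissa (j, !b j) : ℝ)
  have hfl : ∀ b j p q, ⌊U b j p q * M⌋ ∈ Finset.Icc (-Q : ℤ) Q := by
    intro b j p q
    have h1 := abs_le.1 (hUb b j p q)
    have h2 : (Q : ℝ) = 4 * (d : ℝ) ^ 2 * M := by rw [hQ, hM]; push_cast; ring
    rw [Finset.mem_Icc]
    constructor
    · rw [Int.le_floor]
      push_cast
      rw [h2, ← neg_mul]
      exact mul_le_mul_of_nonneg_right h1.1 hM0.le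
    · refine Int.cast_le.1 ((Int.floor_le (U b j p q * M)).trans (?_ : _ ≤ ((Q : ℤ) : ℝ)))
      push_cast
      rw [h2]
      exact mul_le_mul_of_nonneg_right h1.2 hM0.le
  let code : (Fin d → Bool) → Fin (n * n + 3) →
      (Fin d × Bool) × (Fin n → Fin n → Finset.Icc (-Q : ℤ) Q) := fun b l =>
    ((k b l, !b (k b l)), fun p q => ⟨⌊U b (k b l) p q * M⌋, hfl _ _ _ _⟩)
  have hcode : Function.Injective code := by
    intro b b' hbb
    by_contra hne
    obtain ⟨i, hi⟩ := Function.ne_iff.1 hne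
    have hi' : (!b' i) = b i := by
      revert hi
      cases b i <;> cases b' i <;> simp
    obtain ⟨c, hc, hcU, hcN⟩ := hk b' i
    have hl : ∀ l, |(U b' (k b' l) * W b i).trace -
        (((pairAbscissa (i, b i) : ℝ) - pairAbscissa (k b' l, !b' (k b' l))) ^ 2 - 1 / 2)| ≤
          3 / (32 * (n : ℝ) ^ 2) := by
      intro l
      have h1 := congrFun hbb l
      simp only [code, Prod.ext_iff] at h1
      obtain ⟨⟨h2, h3⟩, h4⟩ := h1
      have h5 := hUW b i (k b l)
      have h6 : (k b l, !b (k b l)) = (k b' l, !b' (k b' l)) := Prod.ext h2 h3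
      rw [h6] at h5
      have h7 : ∀ p q, |(U b' (k b' l) - U b (k b l)) p q| ≤ 1 / M := by
        intro p q
        have h8 := congrArg Subtype.val (congrFun (congrFun h4 p) q)
        have h9 := (Int.abs_sub_lt_one_of_floor_eq_floor h8.symm).le
        rw [← sub_mul, abs_mul, abs_of_pos hM0] at h9
        rwa [Matrix.sub_apply, le_div_iff₀ hM0]
      have h8 := abs_trace_mul_le_s17 h7 (hWb b i)
      have h9 : (n : ℝ) ^ 3 * (1 / M) = 1 / (32 * (n : ℝ) ^ 2) := by
        rw [hM]; field_simp
      rw [h9, Matrix.sub_mul, Matrix.trace_sub] at h8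
      have h10 := (abs_add_le _ _).trans (add_le_add h8 h5)
      rw [sub_add_sub_cancel] at h10
      refine h10.trans (le_of_eq ?_)
      field_simp
      norm_num
    have hpos := trace_mul_nonneg (hU b' i) (hW b i)
    have hneg := hcN (pairAbscissa (i, b i))
    rw [hi', sub_self] at hneg
    have hsum : |(U b' i * W b i).trace - (0 ^ 2 - 1 / 2)| ≤
        ∑ _l : Fin (n * n + 3), 3 / (32 * (n : ℝ) ^ 2) := by
      rw [hneg, hcU, Matrix.sum_mul, Matrix.trace_sum, ← Finset.sum_sub_distrib]
      refine (Finset.abs_sum_le_sum_abs _ _).trans (Finset.sum_le_sum fun l _ => ?_)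
      rw [Matrix.smul_mul, Matrix.trace_smul, smul_eq_mul, ← mul_sub, abs_mul]
      exact (mul_le_of_le_one_left (abs_nonneg _) (hc l)).trans (hl l)
    simp only [Finset.sum_const, Finset.card_univ, Fintype.card_fin, nsmul_eq_mul] at hsum
    push_cast at hsum
    have hfin : ((n : ℝ) * n + 3) * (3 / (32 * (n : ℝ) ^ 2)) ≤ 3 / 8 := by
      rw [mul_div_assoc', div_le_iff₀ (by positivity)]
      nlinarith
    have := (abs_le.1 (hsum.trans hfin)).2
    norm_num at this
    linarith
  have hcard := Fintype.card_le_of_injective code hcode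
  have hIcc : Fintype.card (Finset.Icc (-Q : ℤ) Q) = 2 * Q + 1 := by
    rw [Fintype.card_coe, Int.card_Icc]
    omega
  simpa only [Fintype.card_fun, Fintype.card_prod, Fintype.card_bool, Fintype.card_fin, hIcc,
    ← pow_mul] using hcard

theorem not_hasSdpEF_zero {d : ℕ} (hd : 2 ≤ d) (b : Fin d → Bool) :
    ¬ HasSdpEF (convexHull ℝ (parabolaVertices b : Set (Fin 2 → ℝ))) 0 := by
  intro h
  obtain ⟨Y, -, hY⟩ := h.exists_lift _ (parabolaPoint_mem_convexHull b)
  have hle := nonneg_on_convexHull (a := ![-1, 0]) (β := 2 * d)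
    (T := (parabolaVertices b : Set (Fin 2 → ℝ))) (by
      intro y hy
      obtain ⟨l, rfl⟩ := mem_parabolaVertices.1 hy
      have : (pairAbscissa (l, b l) : ℝ) ≤ 2 * d := by exact_mod_cast pairAbscissa_le _
      simp [parabolaPoint]
      linarith)
  let i : Fin d := ⟨0, by omega⟩
  let j : Fin d := ⟨1, by omega⟩
  have hij : i ≠ j := by simp [i, j]
  have h1 := hle _ (hY (Pi.single i (1 - 2 * d : ℝ) + Pi.single j (2 * d : ℝ))
    (by simp [Finset.sum_add_distrib])
    (by rw [Subsingleton.elim (∑ i, _) (0 : Matrix (Fin 0) (Fin 0) ℝ)]; exact .zero))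
  have hN : pairAbscissa (i, b i) + 1 ≤ pairAbscissa (j, b j) := by
    have := (b i).toNat_le
    simp only [pairAbscissa, i, j] at this ⊢
    omega
  have hN' : (pairAbscissa (i, b i) : ℝ) + 1 ≤ pairAbscissa (j, b j) := by exact_mod_cast hN
  have h1i : (1 : ℝ) ≤ pairAbscissa (i, b i) := by exact_mod_cast one_le_pairAbscissa _
  have hd0 : (2 : ℝ) ≤ d := by exact_mod_cast hd
  simp [add_smul, Finset.sum_add_distrib, Pi.single_apply, ite_smul, parabolaPoint] at h1
  nlinarith

theorem counting_bound_le {d n : ℕ} (hd : 3 ≤ d) (hn : 0 < n) (hnd : n ≤ d) :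
    (d * 2 * (2 * (128 * d ^ 2 * n ^ 5) + 1) ^ (n * n)) ^ (n * n + 3) ≤ d ^ (60 * n ^ 4) := by
  have h1 : 2 * (128 * d ^ 2 * n ^ 5) + 1 ≤ d ^ 13 := by
    have a1 : n ^ 5 ≤ d ^ 5 := Nat.pow_le_pow_left hnd 5
    have a2 : 3 ^ 6 ≤ d ^ 6 := Nat.pow_le_pow_left hd 6
    have a3 : 0 < d ^ 7 := by positivity
    calc 2 * (128 * d ^ 2 * n ^ 5) + 1 ≤ 2 * (128 * d ^ 2 * d ^ 5) + 1 := by gcongr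
      _ = 256 * d ^ 7 + 1 := by ring
      _ ≤ 3 ^ 6 * d ^ 7 := by omega
      _ ≤ d ^ 6 * d ^ 7 := by gcongr
      _ = d ^ 13 := by ring
  calc _ ≤ (d * d * (d ^ 13) ^ (n * n)) ^ (n * n + 3) := by gcongr; omega
    _ = d ^ ((2 + 13 * (n * n)) * (n * n + 3)) := by
      rw [← pow_two, ← pow_mul, ← pow_add, ← pow_mul]
    _ ≤ d ^ (60 * n ^ 4) := by
      refine Nat.pow_le_pow_right (by omega) ?_
      have : 1 ≤ n * n := Nat.mul_pos hn hn
      calc _ ≤ (2 * (n * n) + 13 * (n * n)) * (n * n + 3 * (n * n)) := by gcongr <;> omega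
        _ = 60 * n ^ 4 := by ring

theorem div_logb_le_of_two_pow_le {d R : ℕ} (hd : 3 ≤ d)
    (h : 2 ^ d ≤ d ^ (1296 * R ^ 4)) : (d : ℝ) / Real.logb 2 d ≤ (6 * (R : ℝ)) ^ 4 := by
  have hd' : (3 : ℝ) ≤ d := by exact_mod_cast hd
  have hlog : 0 < Real.logb 2 d := Real.logb_pos (by norm_num) (by linarith)
  rw [div_le_iff₀ hlog]
  have h1 : (2 : ℝ) ^ d ≤ (d : ℝ) ^ (1296 * R ^ 4) := by exact_mod_cast h
  have h2 := Real.logb_le_logb_of_le (b := 2) (by norm_num) (by positivity) h1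
  rw [Real.logb_pow, Real.logb_pow, Real.logb_self_eq_one (by norm_num)] at h2
  push_cast at h2
  calc (d : ℝ) ≤ 1296 * R ^ 4 * Real.logb 2 d := by linarith
    _ = _ := by ring

/-- Theorem 5.2 (Integral polygon with high semidefinite extension complexity):
there is a constant `c > 0` such that for every `d ≥ 3` there is a convex
`d`-gon, with integral vertices in `{1,…,2d} × {1,…,4d²}`, whose semidefinite
extension complexity is at least `c (d / log₂ d)^{1/4}`. -/
theorem integral_polygon_high_sdp_xc :
    ∃ c : ℝ, 0 < c ∧ ∀ d : ℕ, 3 ≤ d →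
      ∃ V : Finset (Fin 2 → ℝ),
        V.card = d ∧
        (∀ v ∈ V, (∃ m : ℤ, v 0 = (m : ℝ)) ∧ (∃ m : ℤ, v 1 = (m : ℝ)) ∧
          1 ≤ v 0 ∧ v 0 ≤ 2 * (d : ℝ) ∧ 1 ≤ v 1 ∧ v 1 ≤ 4 * (d : ℝ) ^ 2) ∧
        (∀ v ∈ V, v ∉ convexHull ℝ ((V : Set (Fin 2 → ℝ)) \ {v})) ∧
        c * ((d : ℝ) / Real.logb 2 d) ^ ((1 : ℝ) / 4) ≤
          (xcs (convexHull ℝ (V : Set (Fin 2 → ℝ))) : ℝ) := by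
  refine ⟨1 / 6, by norm_num, fun d hd => ?_⟩
  let x : (Fin d → Bool) → ℕ := fun b =>
    xcs (convexHull ℝ (parabolaVertices b : Set (Fin 2 → ℝ)))
  obtain ⟨b, hb⟩ := Finite.exists_max x
  have hcoord : ∀ v ∈ parabolaVertices b, (∃ m : ℤ, v 0 = (m : ℝ)) ∧ (∃ m : ℤ, v 1 = (m : ℝ)) ∧
      1 ≤ v 0 ∧ v 0 ≤ 2 * (d : ℝ) ∧ 1 ≤ v 1 ∧ v 1 ≤ 4 * (d : ℝ) ^ 2 := by
    intro v hv
    obtain ⟨k, rfl⟩ := mem_parabolaVertices.1 hv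
    set N := pairAbscissa (k, b k)
    have h1 : (1 : ℝ) ≤ N := by exact_mod_cast one_le_pairAbscissa _
    have h2 : (N : ℝ) ≤ 2 * d := by exact_mod_cast pairAbscissa_le _
    refine ⟨⟨N, by simp [parabolaPoint]⟩, ⟨N ^ 2, by simp [parabolaPoint]⟩, ?_⟩
    simp only [parabolaPoint, cons_val_zero, cons_val_one]
    exact ⟨h1, h2, by nlinarith, by nlinarith⟩
  refine ⟨parabolaVertices b, card_parabolaVertices b, hcoord,
    fun v hv => parabolaVertices_convexIndependent b hv, ?_⟩
  have hEF : ∀ b' : Fin d → Bool,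
      HasSdpEF (convexHull ℝ (parabolaVertices b' : Set (Fin 2 → ℝ))) (x b') := by
    intro b'
    refine Nat.sInf_mem (s := {r | HasSdpEF _ r}) ⟨_, hasSdpEF_convexHull _ fun v hv l => ?_⟩
    obtain ⟨k, rfl⟩ := mem_parabolaVertices.1 hv
    fin_cases l <;> simp [parabolaPoint]
  have hR : 0 < x b := Nat.pos_of_ne_zero fun h0 =>
    not_hasSdpEF_zero (by omega) b (h0 ▸ hEF b)
  change _ ≤ (x b : ℝ)
  generalize x b = R at hb hR
  have hd' : (3 : ℝ) ≤ d := by exact_mod_cast hd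
  have hlog : 1 ≤ Real.logb 2 d := by
    rw [Real.le_logb_iff_rpow_le (by norm_num) (by linarith)]
    norm_num
    linarith
  have hmain : (d : ℝ) / Real.logb 2 d ≤ (6 * (R : ℝ)) ^ 4 := by
    have hR1 : (1 : ℝ) ≤ R := by exact_mod_cast hR
    rcases lt_or_ge R d with hlt | hge
    · refine div_logb_le_of_two_pow_le hd ?_
      have h1 := two_pow_le_of_forall_hasSdpEF (d := d) (n := R + 1) (by omega) (by omega)
        fun b' => ⟨x b', by have := hb b'; omega, hEF b'⟩
      refine (h1.trans (counting_bound_le hd (by omega) (by omega))).trans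
        (Nat.pow_le_pow_right (by omega) ?_)
      calc 60 * (R + 1) ^ 4 ≤ 60 * (2 * R) ^ 4 := by gcongr; omega
        _ ≤ 1296 * R ^ 4 := by ring_nf; gcongr; norm_num
    · have hge' : (d : ℝ) ≤ R := by exact_mod_cast hge
      calc (d : ℝ) / Real.logb 2 d ≤ d := div_le_self (by linarith) hlog
        _ ≤ 6 * (R : ℝ) := by linarith
        _ ≤ (6 * (R : ℝ)) ^ 4 := le_self_pow₀ (by linarith) (by norm_num)
  have h2 := Real.rpow_le_rpow (by positivity) hmain (by norm_num : (0 : ℝ) ≤ 1 / 4)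
  rw [← Real.rpow_natCast, ← Real.rpow_mul (by positivity)] at h2
  norm_num at h2
  norm_num
  linarith
end
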